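/- arXiv:1504.03755 — 2 statements merged into one kernel-verified Lean document; each statement's English description precedes it below -/
import Mathlib

section
/- Let K be an algebraically closed field and fix n ≥ 1, r ≥ 1, and degrees d₁, …, d_r ≥ 1. For each j let M_j be the set of monomials of total degree d_j in y₀, …, yₙ. For a coefficient tuple c = (c⁽¹⁾, …, c⁽ʳ⁾) with c⁽ʲ⁾ ∈ K^{M_j}, let F_j(c) = Σ_{μ ∈ M_j} c⁽ʲ⁾_μ · μ, a homogeneous polynomial of degree d_j, and let V_c = { [y] ∈ ℙ^n(K) : F_j(c)(y) = 0 for all j = 1, …, r } ⊆ ℙ^n(K). Then the set { c : V_c is an irreducible subset of ℙ^n(K) } is a constructible subset of the coefficient space ∏_j K^{M_j} with respect to the Zariski topology. (This is Theorem A.2 of the paper's appendix: irreducibility of Zariski closed subsets of projective space is definable in families.) -/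
/-- The Zariski topology on affine space `σ → K`: the closed sets are the common
zero loci of sets of polynomials over `K`. -/
def zariskiTopology (K : Type*) [CommRing K] (σ : Type*) :
    TopologicalSpace (σ → K) :=
  TopologicalSpace.generateFrom
    {U | ∃ f : MvPolynomial σ K, U = {x | MvPolynomial.eval x f ≠ 0}}

/-- A set is constructible w.r.t. a topology `t` if it is a finite union of
differences of `t`-closed sets (equivalently, a finite Boolean combination of
closed sets). -/
def IsConstructibleIn {α : Type*} (t : TopologicalSpace α) (S : Set α) : Prop :=
  ∃ (r : ℕ) (C D : Fin r → Set α),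
    (∀ i, @IsClosed _ t (C i)) ∧ (∀ i, @IsClosed _ t (D i)) ∧
    S = ⋃ i, C i \ D i

/-- The set of monomials in `n` variables of total degree exactly `d`, encoded
by their exponent vectors. -/
abbrev MonoEq (n d : ℕ) : Type :=
  {e : Fin n → Fin (d + 1) // (∑ i, ((e i : ℕ))) = d}

/-- The homogeneous polynomial `Σ_{μ ∈ M_d} c_μ · μ` of degree `d` with
coefficient tuple `c`. -/
noncomputable def homPolyOf {K : Type*} [CommRing K] {n d : ℕ}
    (c : MonoEq n d → K) : MvPolynomial (Fin n) K :=
  ∑ e : MonoEq n d,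
    MvPolynomial.monomial (Finsupp.equivFunOnFinite.symm fun i => ((e.1 i : ℕ)))
      (c e)

/-- The Zariski topology on projective `n`-space over `K`: the closed sets are
the common zero loci of sets of homogeneous polynomials in `y₀, …, yₙ`. -/
def projZariskiTopology (K : Type*) [Field K] (n : ℕ) :
    TopologicalSpace (Projectivization K (Fin (n + 1) → K)) :=
  TopologicalSpace.generateFrom
    {U | ∃ (d : ℕ) (f : MvPolynomial (Fin (n + 1)) K), f.IsHomogeneous d ∧
      U = {p | MvPolynomial.eval p.rep f ≠ 0}}

open MvPolynomial

section Constructible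

variable {K : Type*} [Field K]

/-- The set of closed points of affine space lying in some constructible subset of the
prime spectrum of the polynomial ring. -/
def IsPointConstructible {σ : Type*} (S : Set (σ → K)) : Prop :=
  ∃ Z : Set (PrimeSpectrum (MvPolynomial σ K)),
    Topology.IsConstructible Z ∧ S = {x | pointToPoint (k := K) x ∈ Z}

lemma mem_pointToPoint_iff {σ : Type*} (x : σ → K) (f : MvPolynomial σ K) :
    f ∈ (pointToPoint (k := K) x).asIdeal ↔ eval x f = 0 := by
  simp [pointToPoint, aeval_eq_eval]

namespace IsPointConstructible

variable {σ τ : Type*} {S T : Set (σ → K)}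

lemma compl (hS : IsPointConstructible S) : IsPointConstructible Sᶜ := by
  obtain ⟨Z, hZ, rfl⟩ := hS
  exact ⟨Zᶜ, hZ.compl, rfl⟩

lemma inter (hS : IsPointConstructible S) (hT : IsPointConstructible T) :
    IsPointConstructible (S ∩ T) := by
  obtain ⟨Z, hZ, rfl⟩ := hS
  obtain ⟨W, hW, rfl⟩ := hT
  exact ⟨Z ∩ W, hZ.inter hW, rfl⟩

lemma iInter {ι : Type*} [Finite ι] {S : ι → Set (σ → K)}
    (hS : ∀ i, IsPointConstructible (S i)) : IsPointConstructible (⋂ i, S i) := by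
  choose Z hZ hS using hS
  refine ⟨⋂ i, Z i, .iInter hZ, ?_⟩
  ext x
  simp [hS]

lemma eval_ne_zero (f : MvPolynomial σ K) : IsPointConstructible {x | eval x f ≠ 0} := by
  refine ⟨PrimeSpectrum.basicOpen f, PrimeSpectrum.isConstructible_basicOpen, ?_⟩
  ext x
  simp [mem_pointToPoint_iff]

lemma eval_eq_zero (f : MvPolynomial σ K) : IsPointConstructible {x | eval x f = 0} := by
  simpa [Set.compl_def] using (eval_ne_zero f).compl

/-- **Chevalley's theorem** for projections of constructible sets of points. -/
lemma exists_sumElim [IsAlgClosed K] [Finite σ] [Finite τ] {S : Set (σ ⊕ τ → K)}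
    (hS : IsPointConstructible S) :
    IsPointConstructible {x : σ → K | ∃ y : τ → K, Sum.elim x y ∈ S} := by
  obtain ⟨Z, hZ, rfl⟩ := hS
  let φ : MvPolynomial σ K →+* MvPolynomial (σ ⊕ τ) K :=
    (rename Sum.inl : MvPolynomial σ K →ₐ[K] MvPolynomial (σ ⊕ τ) K).toRingHom
  have hφ : φ.FinitePresentation := by
    rw [← RingHom.FinitePresentation.of_finiteType]
    refine RingHom.FiniteType.of_comp_finiteType (f := C) ?_
    have : φ.comp C = algebraMap K (MvPolynomial (σ ⊕ τ) K) := by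
      ext a
      simp [φ, algebraMap_eq]
    rw [this, RingHom.finiteType_algebraMap]
    infer_instance
  refine ⟨_, PrimeSpectrum.isConstructible_comap_image hφ hZ, ?_⟩
  obtain ⟨D, rfl⟩ := PrimeSpectrum.exists_constructibleSetData_iff.mpr hZ
  ext x
  constructor
  · rintro ⟨y, hy⟩
    refine ⟨_, hy, ?_⟩
    ext f
    simp only [PrimeSpectrum.comap_asIdeal, Ideal.mem_comap]
    rw [mem_pointToPoint_iff, mem_pointToPoint_iff]
    simp [φ, eval_rename]
  · rintro ⟨p, hp, hpx⟩
    simp only [PrimeSpectrum.ConstructibleSetData.toSet, Set.mem_iUnion, exists_prop,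
      PrimeSpectrum.BasicConstructibleSetData.toSet, Set.mem_sdiff, PrimeSpectrum.mem_zeroLocus,
      Set.singleton_subset_iff, SetLike.mem_coe] at hp
    obtain ⟨E, hE, hEg, hEf⟩ := hp
    have hf : ∃ z ∈ zeroLocus K p.asIdeal, eval z E.f ≠ 0 := by
      by_contra! h
      apply hEf
      rw [← IsPrime.vanishingIdeal_zeroLocus (K := K) p.asIdeal]
      intro z hz
      simpa [aeval_eq_eval] using h z hz
    obtain ⟨z, hz, hzf⟩ := hf
    have hzx : ∀ i, z (Sum.inl i) = x i := by
      intro i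
      have h1 : X i - C (x i) ∈ (pointToPoint (k := K) x).asIdeal := by
        rw [mem_pointToPoint_iff]; simp
      rw [← hpx] at h1
      have h2 := hz _ h1
      simpa [φ, sub_eq_zero] using h2
    have hzz : Sum.elim x (z ∘ Sum.inr) = z := by
      ext (i | i) <;> simp [hzx]
    refine ⟨z ∘ Sum.inr, ?_⟩
    simp only [hzz, PrimeSpectrum.ConstructibleSetData.toSet, Set.mem_iUnion, exists_prop,
      PrimeSpectrum.BasicConstructibleSetData.toSet, Set.mem_sdiff, PrimeSpectrum.mem_zeroLocus,
      Set.singleton_subset_iff, SetLike.mem_coe, Set.mem_ofPred_eq]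
    refine ⟨E, hE, ?_, ?_⟩
    · intro f hf
      exact (mem_pointToPoint_iff z f).2 (by simpa [aeval_eq_eval] using hz _ (hEg hf))
    · rwa [mem_pointToPoint_iff]

lemma isConstructibleIn (hS : IsPointConstructible S) :
    IsConstructibleIn (zariskiTopology K σ) S := by
  obtain ⟨Z, hZ, rfl⟩ := hS
  obtain ⟨D, rfl⟩ := PrimeSpectrum.exists_constructibleSetData_iff.mpr hZ
  have hclosed : ∀ f : MvPolynomial σ K,
      @IsClosed _ (zariskiTopology K σ) {x | eval x f = 0} := by
    intro f
    let _ := zariskiTopology K σ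
    rw [← isOpen_compl_iff]
    exact TopologicalSpace.isOpen_generateFrom_of_mem ⟨f, rfl⟩
  let E : Fin D.card → PrimeSpectrum.BasicConstructibleSetData (MvPolynomial σ K) :=
    fun i => (D.equivFin.symm i).1
  refine ⟨D.card, fun i => ⋂ j, {x | eval x ((E i).g j) = 0}, fun i => {x | eval x (E i).f = 0},
    fun i => @isClosed_iInter _ _ (zariskiTopology K σ) _ fun j => hclosed _,
    fun i => hclosed _, ?_⟩
  ext x
  simp only [PrimeSpectrum.ConstructibleSetData.toSet, Set.mem_iUnion, exists_prop,
    PrimeSpectrum.BasicConstructibleSetData.toSet, Set.mem_sdiff, PrimeSpectrum.mem_zeroLocus,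
    Set.singleton_subset_iff, SetLike.mem_coe, Set.mem_ofPred_eq, Set.range_subset_iff,
    Set.mem_iInter, mem_pointToPoint_iff]
  constructor
  · rintro ⟨B, hB, h⟩
    obtain ⟨i, hi⟩ := D.equivFin.symm.surjective ⟨B, hB⟩
    obtain rfl : E i = B := congrArg Subtype.val hi
    exact ⟨i, h⟩
  · rintro ⟨i, h⟩
    exact ⟨E i, (D.equivFin.symm i).2, h⟩

end IsPointConstructible

end Constructible

section Homogeneous

variable {K ι κ : Type*} [Field K]

lemma MvPolynomial.IsHomogeneous.homogeneousComponent_mul {t : MvPolynomial ι K} {m : ℕ}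
    (ht : t.IsHomogeneous m) (g : MvPolynomial ι K) (k : ℕ) :
    homogeneousComponent k (t * g) = if m ≤ k then t * homogeneousComponent (k - m) g else 0 := by
  let _ := MvPolynomial.gradedAlgebra (R := K) (σ := ι)
  have := DirectSum.coe_decompose_mul_of_left_mem (homogeneousSubmodule ι K) (b := g) k ht
  have h (p : MvPolynomial ι K) (i : ℕ) :
      ((DirectSum.decompose (homogeneousSubmodule ι K) p i : homogeneousSubmodule ι K i) :
        MvPolynomial ι K) = homogeneousComponent i p :=
    decomposition.decompose'_apply p i
  rw [h] at this
  simpa only [h] using this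

lemma MvPolynomial.homogeneousComponent_mem_span_range {d : κ → ℕ} {F : κ → MvPolynomial ι K}
    (hF : ∀ j, (F j).IsHomogeneous (d j)) {p : MvPolynomial ι K}
    (hp : p ∈ Ideal.span (Set.range F)) (k : ℕ) :
    homogeneousComponent k p ∈ Ideal.span (Set.range F) := by
  let _ := MvPolynomial.gradedAlgebra (R := K) (σ := ι)
  refine homogeneousComponent_mem_of_mem (Ideal.homogeneous_span _ _ ?_) hp k
  rintro _ ⟨j, rfl⟩
  exact ⟨d j, hF j⟩

/-- A homogeneous system whose only zero is the origin contains a power of the irrelevant ideal. -/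
lemma exists_idealOfVars_pow_le [IsAlgClosed K] [Finite ι] {I : Ideal (MvPolynomial ι K)}
    (h : ∀ y ∈ zeroLocus K I, y = 0) : ∃ s, idealOfVars ι K ^ s ≤ I := by
  refine Ideal.exists_pow_le_of_le_radical_of_fg ?_ (idealOfVars_fg ι K)
  rw [← vanishingIdeal_zeroLocus_eq_radical (K := K), idealOfVars, Ideal.span_le]
  rintro _ ⟨i, rfl⟩ y hy
  simp [h y hy]

/-- Containing a given power of the irrelevant ideal is an open condition on the coefficients of
homogeneous generators. -/
lemma exists_eval_ne_zero_idealOfVars_pow_le {σ : Type*} [Finite ι] [Fintype κ] {d : κ → ℕ}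
    {F : κ → MvPolynomial ι (MvPolynomial σ K)} (hF : ∀ j, (F j).IsHomogeneous (d j))
    (c₀ : σ → K) {s : ℕ}
    (h : idealOfVars ι K ^ s ≤ Ideal.span (Set.range fun j => map (eval c₀) (F j))) :
    ∃ f : MvPolynomial σ K, eval c₀ f ≠ 0 ∧ ∀ c, eval c f ≠ 0 →
      idealOfVars ι K ^ s ≤ Ideal.span (Set.range fun j => map (eval c) (F j)) := by
  classical
  let _ := Fintype.ofFinite ι
  obtain ⟨M, hM⟩ : ∃ M : Finset (ι →₀ ℕ), ∀ x, x ∈ M ↔ x.degree = s :=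
    ⟨Finset.univ.finsuppAntidiag s, fun x => by
      simp [Finset.mem_finsuppAntidiag, Finsupp.degree_eq_sum]⟩
  have h1 (x : M) : ∃ a : κ → MvPolynomial ι K,
      ∑ j, a j * map (eval c₀) (F j) = monomial x.1 1 := by
    rw [← Ideal.mem_span_range_iff_exists_fun]
    apply h
    rw [monomial_mem_pow_idealOfVars_iff _ _ one_ne_zero, (hM _).1 x.2]
  choose a ha using h1
  let G (x : M) : MvPolynomial ι (MvPolynomial σ K) :=
    ∑ j, map C (a x j) * F j
  have hG (c : σ → K) (x : M) : map (eval c) (G x) = ∑ j, a x j * map (eval c) (F j) := by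
    have : (eval c).comp (C : K →+* MvPolynomial σ K) = RingHom.id K := by ext; simp
    simp [G, map_map, this, MvPolynomial.map_id]
  let A : Matrix M M (MvPolynomial σ K) := fun x y => coeff y.1 (G x)
  have hA (c : σ → K) : eval c A.det = (A.map (eval c)).det := by
    rw [RingHom.map_det]; rfl
  have hA' (c : σ → K) (x y : M) : A.map (eval c) x y = coeff y.1 (map (eval c) (G x)) :=
    (coeff_map (eval c) (G x) y.1).symm
  refine ⟨A.det, ?_, fun c hc => ?_⟩
  · have : A.map (eval c₀) = 1 := by
      ext x y
      simp only [hA', hG, ha, coeff_monomial, Matrix.one_apply, Subtype.ext_iff]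
    simp [hA, this]
  · rw [hA] at hc
    rw [pow_idealOfVars_eq_span, Ideal.span_le]
    rintro _ ⟨y, hy, rfl⟩
    let y' : M := ⟨y, (hM y).2 hy⟩
    have hcomp (x : M) : homogeneousComponent s (map (eval c) (G x)) =
        ∑ z : M, monomial z.1 (A.map (eval c) x z) := by
      ext w
      simp only [coeff_homogeneousComponent, coeff_sum, coeff_monomial, hA']
      split_ifs with hw
      · rw [Finset.sum_eq_single ⟨w, (hM w).2 hw⟩]
        · simp
        · intro z _ hz
          rw [if_neg]
          rintro rfl
          exact hz rfl
        · simp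
      · rw [Finset.sum_eq_zero]
        intro z _
        rw [if_neg]
        rintro rfl
        exact hw ((hM _).1 z.2)
    have key : monomial y (1 : K) = ∑ x : M, C ((A.map (eval c))⁻¹ y' x) *
        homogeneousComponent s (map (eval c) (G x)) := by
      simp only [hcomp, Finset.mul_sum, C_mul_monomial]
      rw [Finset.sum_comm]
      simp only [← map_sum]
      have h2 (z : M) : ∑ x, (A.map (eval c))⁻¹ y' x * (A.map (eval c)) x z =
          (1 : Matrix M M K) y' z := by
        rw [← Matrix.mul_apply, Matrix.nonsing_inv_mul _ (isUnit_iff_ne_zero.2 hc)]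
      simp only [h2, Matrix.one_apply]
      rw [Finset.sum_eq_single y'] <;> simp +contextual [y', eq_comm]
    change monomial y (1 : K) ∈ _
    rw [key]
    refine Ideal.sum_mem _ fun x _ => Ideal.mul_mem_left _ _ ?_
    refine homogeneousComponent_mem_span_range (fun j => (hF j).map _) ?_ s
    rw [hG]
    exact Ideal.mem_span_range_iff_exists_fun.2 ⟨_, rfl⟩

/-- The vector space spanned by the products of a monomial in `t` with exponents at most `k` and a
monomial in the variables with exponents less than `s`. -/
noncomputable def boxSpan (t : κ → MvPolynomial ι K) (s k : ℕ) [Fintype κ] [Fintype ι] :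
    Submodule K (MvPolynomial ι K) :=
  Submodule.span K (Set.range fun x : (κ → Fin (k + 1)) × (ι → Fin s) =>
    (∏ i, t i ^ (x.1 i : ℕ)) * ∏ i, X i ^ (x.2 i : ℕ))

section boxSpan

variable [Fintype κ] [Fintype ι] {t : κ → MvPolynomial ι K} {s : ℕ}

lemma mem_boxSpan {k : ℕ} (a : κ → ℕ) (b : ι → ℕ) (ha : ∀ i, a i ≤ k) (hb : ∀ i, b i < s) :
    (∏ i, t i ^ a i) * ∏ i, X i ^ b i ∈ boxSpan t s k :=
  Submodule.subset_span
    ⟨(fun i => ⟨a i, Nat.lt_succ_of_le (ha i)⟩, fun i => ⟨b i, hb i⟩), rfl⟩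

lemma boxSpan_mono {k l : ℕ} (h : k ≤ l) : boxSpan t s k ≤ boxSpan t s l := by
  rw [boxSpan, Submodule.span_le]
  rintro _ ⟨x, rfl⟩
  exact mem_boxSpan _ _ (fun i => (Nat.le_of_lt_succ (x.1 i).2).trans h) fun i => (x.2 i).2

lemma mul_mem_boxSpan {k : ℕ} (j : κ) {p : MvPolynomial ι K} (hp : p ∈ boxSpan t s k) :
    t j * p ∈ boxSpan t s (k + 1) := by
  classical
  have : boxSpan t s k ≤ (boxSpan t s (k + 1)).comap (LinearMap.mulLeft K (t j)) := by
    rw [boxSpan, Submodule.span_le]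
    rintro _ ⟨x, rfl⟩
    have h := mem_boxSpan (t := t) (s := s) (k := k + 1) (fun i => x.1 i + if i = j then 1 else 0)
      (fun i => x.2 i) (fun i => by have := (x.1 i).2; split_ifs <;> omega) fun i => (x.2 i).2
    simp only [pow_add, Finset.prod_mul_distrib, pow_ite, pow_one, pow_zero, Finset.prod_ite_eq',
      Finset.mem_univ, if_true] at h
    simp only [Submodule.comap_coe, Set.mem_preimage, LinearMap.mulLeft_apply, SetLike.mem_coe]
    convert h using 1
    ring
  exact this hp

/-- Let `t` be linear forms such that `t` and the homogeneous ideal `I` generate an ideal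
containing the `s`-th power of the irrelevant ideal. Then, modulo `I`, every polynomial of degree
at most `k` is a combination of the products of a monomial in `t` with exponents at most `k` and a
monomial in the variables with exponents less than `s`. -/
lemma mem_sup_boxSpan_of_isHomogeneous {I : Ideal (MvPolynomial ι K)}
    (hI : ∀ p ∈ I, ∀ k, homogeneousComponent k p ∈ I)
    (ht : ∀ i, (t i).IsHomogeneous 1)
    (h : idealOfVars ι K ^ s ≤ I ⊔ Ideal.span (Set.range t)) (k : ℕ)
    {p : MvPolynomial ι K} (hp : p.IsHomogeneous k) :
    p ∈ I.restrictScalars K ⊔ boxSpan t s k := by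
  classical
  induction k using Nat.strong_induction_on generalizing p with | _ k ih => ?_
  by_cases hks : k < s
  · refine Submodule.mem_sup_right ?_
    rw [p.as_sum]
    refine Submodule.sum_mem _ fun b hb => ?_
    rw [← mul_one (coeff b p), ← smul_eq_mul, ← smul_monomial]
    refine Submodule.smul_mem _ _ ?_
    have hbk := hp (mem_support_iff.1 hb)
    have := mem_boxSpan (t := t) (s := s) (k := k) 0 b (by simp) fun i => by
      have := Finsupp.le_degree i b
      rw [Finsupp.degree_eq_weight_one] at this
      exact (this.trans hbk.le).trans_lt hks
    simpa [monomial_eq, Finsupp.prod_fintype] using this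
  · have hmem : p ∈ idealOfVars ι K ^ s := by
      rw [mem_pow_idealOfVars_iff]
      intro x hx
      have := hp (mem_support_iff.1 hx)
      rw [Finsupp.degree_eq_weight_one]
      exact (not_lt.1 hks).trans this.ge
    obtain ⟨i, hi, q, hq, hiq⟩ := Submodule.mem_sup.1 (h hmem)
    obtain ⟨g, rfl⟩ := Ideal.mem_span_range_iff_exists_fun.1 hq
    have hpk : p = homogeneousComponent k i +
        ∑ j, if 1 ≤ k then t j * homogeneousComponent (k - 1) (g j) else 0 := by
      conv_lhs => rw [← (homogeneousComponent_of_mem hp).trans (if_pos rfl), ← hiq]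
      simp only [map_add, map_sum, mul_comm (g _), (ht _).homogeneousComponent_mul]
    rw [hpk]
    refine Submodule.add_mem _ (Submodule.mem_sup_left (hI _ hi _))
      (Submodule.sum_mem _ fun j _ => ?_)
    split_ifs with hk
    · obtain ⟨u, hu, v, hv, huv⟩ := Submodule.mem_sup.1
        (ih (k - 1) (by omega) (homogeneousComponent_isHomogeneous (k - 1) (g j)))
      rw [← huv, mul_add]
      refine Submodule.add_mem_sup (I.mul_mem_left _ hu) ?_
      have := mul_mem_boxSpan j hv
      rwa [Nat.sub_add_cancel hk] at this
    · exact zero_mem _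

lemma mem_sup_boxSpan {I : Ideal (MvPolynomial ι K)}
    (hI : ∀ p ∈ I, ∀ k, homogeneousComponent k p ∈ I)
    (ht : ∀ i, (t i).IsHomogeneous 1)
    (h : idealOfVars ι K ^ s ≤ I ⊔ Ideal.span (Set.range t)) {k : ℕ}
    {p : MvPolynomial ι K} (hp : p.totalDegree ≤ k) :
    p ∈ I.restrictScalars K ⊔ boxSpan t s k := by
  rw [← sum_homogeneousComponent p]
  refine Submodule.sum_mem _ fun i hi => ?_
  have hik : i ≤ k := by have := Finset.mem_range.1 hi; omega
  exact sup_le_sup_left (boxSpan_mono hik) (I.restrictScalars K)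
    (mem_sup_boxSpan_of_isHomogeneous hI ht h i (homogeneousComponent_isHomogeneous i p))

end boxSpan

end Homogeneous

section Relation

variable {K ι κ : Type*} [Field K]

lemma MvPolynomial.totalDegree_aeval_le {u : κ → MvPolynomial ι K}
    (hu : ∀ i, (u i).totalDegree ≤ 1) (p : MvPolynomial κ K) :
    (aeval u p).totalDegree ≤ p.totalDegree := by
  rw [aeval_def, eval₂_eq]
  refine totalDegree_finsetSum_le fun b hb => ?_
  refine (totalDegree_mul _ _).trans ?_
  rw [algebraMap_eq, totalDegree_C, zero_add]
  refine (totalDegree_finsetProd _ _).trans (le_trans ?_ (le_totalDegree hb))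
  refine Finset.sum_le_sum fun i _ => (totalDegree_pow _ _).trans ?_
  simpa using Nat.mul_le_mul_left (b i) (hu i)

/-- The bound on the degree of an algebraic relation among `e + 1` linear forms
given by `exists_relation`. -/
def relationDegree (e m : ℕ) : ℕ := (e + 1) * ((e + 1) ^ e * m)

lemma pow_mul_lt_pow_succ (e m : ℕ) :
    (relationDegree e m + 1) ^ e * m < ((e + 1) ^ e * m + 1) ^ (e + 1) := by
  set k := (e + 1) ^ e * m with hk
  calc (relationDegree e m + 1) ^ e * m
      ≤ ((e + 1) * (k + 1)) ^ e * m := by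
        gcongr
        rw [relationDegree, ← hk]
        nlinarith
    _ = (k + 1) ^ e * k := by rw [mul_pow, hk]; ring
    _ < (k + 1) ^ e * (k + 1) := by gcongr; omega
    _ = _ := (pow_succ _ _).symm

/-- Under the assumptions of `mem_sup_boxSpan`, a linear form satisfies modulo `I` an
algebraic relation of bounded degree over the forms `t`. -/
lemma exists_relation [Fintype ι] {I : Ideal (MvPolynomial ι K)}
    (hI : ∀ p ∈ I, ∀ k, homogeneousComponent k p ∈ I) {e s : ℕ} {t : Fin e → MvPolynomial ι K}
    (ht : ∀ i, (t i).IsHomogeneous 1)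
    (h : idealOfVars ι K ^ s ≤ I ⊔ Ideal.span (Set.range t))
    {l : MvPolynomial ι K} (hl : l.IsHomogeneous 1) :
    ∃ χ : MvPolynomial (Fin (e + 1)) K, χ ≠ 0 ∧
      χ.totalDegree ≤ relationDegree e (s ^ Fintype.card ι) ∧
      aeval (Fin.cons l t : Fin (e + 1) → MvPolynomial ι K) χ ∈ I := by
  classical
  set m := s ^ Fintype.card ι
  set k := (e + 1) ^ e * m with hk
  set u : Fin (e + 1) → MvPolynomial ι K := Fin.cons l t
  have hu (i) : (u i).totalDegree ≤ 1 := by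
    refine Fin.cases ?_ (fun i => ?_) i
    · exact hl.totalDegree_le
    · exact (ht i).totalDegree_le
  let mon (b : Fin (e + 1) → Fin (k + 1)) : MvPolynomial (Fin (e + 1)) K :=
    monomial (Finsupp.equivFunOnFinite.symm fun i => (b i : ℕ)) 1
  have hmon (b) : (mon b).totalDegree ≤ relationDegree e m := by
    refine (totalDegree_monomial_le _ _).trans ?_
    rw [Finsupp.sum_fintype _ _ (fun _ => rfl)]
    refine (Finset.sum_le_card_nsmul _ _ k fun i _ => Nat.le_of_lt_succ (b i).2).trans ?_
    simp [relationDegree, hk]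
  let q := (I.restrictScalars K).mkQ
  let W := Submodule.span K (Set.range
    fun x : (Fin e → Fin (relationDegree e m + 1)) × (ι → Fin s) =>
      q ((∏ i, t i ^ (x.1 i : ℕ)) * ∏ i, X i ^ (x.2 i : ℕ)))
  have hWmap : W = (boxSpan t s (relationDegree e m)).map q := by
    rw [boxSpan, Submodule.map_span, ← Set.range_comp]; rfl
  have hW (b) : q (aeval u (mon b)) ∈ W := by
    obtain ⟨i, hi, v, hv, hiv⟩ := Submodule.mem_sup.1
      (mem_sup_boxSpan hI ht h ((totalDegree_aeval_le hu _).trans (hmon b)))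
    have hqi : q i = 0 := (Submodule.Quotient.mk_eq_zero _).2 hi
    rw [← hiv, map_add, hqi, zero_add, hWmap]
    exact Submodule.mem_map_of_mem hv
  have : Module.Finite K W := FiniteDimensional.span_of_finite K (Set.finite_range _)
  have hdep : ¬ LinearIndependent K fun b => (⟨_, hW b⟩ : W) := by
    intro hli
    have h1 := hli.fintype_card_le_finrank
    have h2 := finrank_range_le_card (R := K)
      fun x : (Fin e → Fin (relationDegree e m + 1)) × (ι → Fin s) =>
      q ((∏ i, t i ^ (x.1 i : ℕ)) * ∏ i, X i ^ (x.2 i : ℕ))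
    have h3 := h1.trans h2
    simp only [Fintype.card_prod, Fintype.card_fun, Fintype.card_fin] at h3
    exact absurd h3 (not_le.2 (pow_mul_lt_pow_succ e m))
  obtain ⟨g, hg, b, hb⟩ := Fintype.not_linearIndependent_iff.1 hdep
  have hcoe : ∑ b, g b • q (aeval u (mon b)) = 0 := by simpa using congrArg Subtype.val hg
  refine ⟨∑ b, g b • mon b, ?_, ?_, ?_⟩
  · intro h0
    have := congrArg (coeff (Finsupp.equivFunOnFinite.symm fun i => (b i : ℕ))) h0
    rw [coeff_sum, Finset.sum_eq_single b] at this
    · exact hb (by simpa [mon] using this)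
    · intro b' _ hbb'
      simp only [mon, coeff_smul, coeff_monomial]
      rw [if_neg, smul_zero]
      intro heq
      refine hbb' (funext fun i => Fin.ext ?_)
      exact congrFun (Finsupp.equivFunOnFinite.symm.injective heq) i
    · simp
  · exact totalDegree_finsetSum_le fun b _ => (totalDegree_smul_le _ _).trans (hmon b)
  · rw [← Submodule.restrictScalars_mem K, ← Submodule.Quotient.mk_eq_zero]
    change q _ = 0
    simpa using hcoe

end Relation

section Projection

variable {K ι : Type*} [Field K]

/-- There are `e` linear forms whose only common zero on `C` is the origin. -/
def HasFiniteProjection (C : Set (ι → K)) (e : ℕ) : Prop :=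
  ∃ t : Fin e → MvPolynomial ι K, (∀ i, (t i).IsHomogeneous 1) ∧
    ∀ y ∈ C, (∀ i, eval y (t i) = 0) → y = 0

lemma hasFiniteProjection_card [Fintype ι] (C : Set (ι → K)) :
    HasFiniteProjection C (Fintype.card ι) := by
  refine ⟨fun i => X ((Fintype.equivFin ι).symm i), fun i => isHomogeneous_X _ _, fun y _ h => ?_⟩
  funext i
  simpa using h (Fintype.equivFin ι i)

lemma MvPolynomial.eval_aeval {κ : Type*} (t : κ → MvPolynomial ι K) (y : ι → K)
    (f : MvPolynomial κ K) : eval y (aeval t f) = eval (fun i => eval y (t i)) f := by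
  have : (eval y).comp (aeval t : MvPolynomial κ K →ₐ[K] _).toRingHom =
      eval fun i => eval y (t i) := by
    ext <;> simp
  exact congr($this f)

lemma MvPolynomial.IsHomogeneous.eval_smul {R : Type*} [CommSemiring R] {d : ℕ}
    {p : MvPolynomial ι R} (hp : p.IsHomogeneous d) (a : R) (y : ι → R) :
    eval (a • y) p = a ^ d * eval y p := by
  rw [eval_eq, eval_eq, Finset.mul_sum]
  refine Finset.sum_congr rfl fun b hb => ?_
  have hb' : b.degree = d := by
    rw [Finsupp.degree_eq_weight_one]; exact hp (mem_support_iff.1 hb)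
  simp only [Pi.smul_apply, smul_eq_mul, mul_pow, Finset.prod_mul_distrib,
    Finset.prod_pow_eq_pow_sum]
  rw [← hb', Finsupp.degree_apply]
  ring

/-- A system of linear forms with trivial common zero on the cone `C`, of minimal length, is
algebraically independent on `C`. -/
lemma exists_eval_aeval_ne_zero [Infinite K] {C : Set (ι → K)} (h0 : 0 ∈ C)
    (hC : ∀ y ∈ C, ∀ a : K, a • y ∈ C) {e : ℕ} (hmin : ∀ e' < e, ¬ HasFiniteProjection C e')
    {t : Fin e → MvPolynomial ι K} (ht : ∀ i, (t i).IsHomogeneous 1)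
    (htC : ∀ y ∈ C, (∀ i, eval y (t i) = 0) → y = 0)
    {f : MvPolynomial (Fin e) K} (hf : f ≠ 0) : ∃ y ∈ C, eval y (aeval t f) ≠ 0 := by
  by_contra! H
  simp only [eval_aeval] at H
  obtain ⟨a, ha⟩ : ∃ a, eval a f ≠ 0 := by
    by_contra! h
    exact hf (MvPolynomial.funext fun x => by simpa using h x)
  have hat : ∀ y ∈ C, (fun i => eval y (t i)) ≠ a := by
    rintro y hy rfl
    exact ha (H y hy)
  have ha0 : a ≠ 0 := by
    rintro rfl
    refine hat 0 h0 (funext fun i => ?_)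
    simpa using (ht i).eval_smul 0 0
  obtain ⟨j, hj⟩ := Function.ne_iff.1 ha0
  obtain _ | e := e
  · exact j.elim0
  refine hmin e (Nat.lt_succ_self e) ⟨fun i => MvPolynomial.C (a j) * t (j.succAbove i) -
    MvPolynomial.C (a (j.succAbove i)) * t j, fun i => ?_, fun y hy h => ?_⟩
  · exact Submodule.sub_mem (homogeneousSubmodule ι K 1)
      (by simpa using (isHomogeneous_C ι (a j)).mul (ht (j.succAbove i)))
      (by simpa using (isHomogeneous_C ι (a (j.succAbove i))).mul (ht j))
  · simp only [map_sub, map_mul, eval_C, sub_eq_zero] at h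
    have hall (i) : a j * eval y (t i) = a i * eval y (t j) := by
      obtain rfl | ⟨i, rfl⟩ := Fin.eq_self_or_eq_succAbove j i
      · rfl
      · exact h i
    by_cases hyj : eval y (t j) = 0
    · refine htC y hy fun i => ?_
      have := hall i
      rw [hyj, mul_zero] at this
      exact (mul_eq_zero.1 this).resolve_left hj
    · exfalso
      refine hat _ (hC y hy (a j / eval y (t j))) (funext fun i => ?_)
      rw [(ht i).eval_smul, pow_one, div_mul_eq_mul_div, hall i, mul_div_cancel_right₀ _ hyj]

lemma RingHom.isIntegral_of_forall_exists_sum {A B κ : Type*} [CommRing A] [CommRing B]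
    [Fintype κ] (φ : A →+* B) (v : κ → B) (h : ∀ b, ∃ f : κ → A, b = ∑ k, φ (f k) * v k) :
    φ.IsIntegral := by
  let _ : Algebra A B := φ.toAlgebra
  have : Module.Finite A B := ⟨⟨(Set.finite_range v).toFinset, by
    rw [Set.Finite.coe_toFinset, eq_top_iff]
    rintro b -
    obtain ⟨f, rfl⟩ := h b
    exact Submodule.sum_mem _ fun k _ =>
      Submodule.smul_mem _ (f k) (Submodule.subset_span ⟨k, rfl⟩)⟩⟩
  exact algebraMap_isIntegral_iff.2 inferInstance

lemma isIntegral_quotient_comp_aeval [Fintype ι] {I P : Ideal (MvPolynomial ι K)}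
    (hI : ∀ p ∈ I, ∀ k, homogeneousComponent k p ∈ I) (hIP : I ≤ P)
    {e s : ℕ} {t : Fin e → MvPolynomial ι K} (ht : ∀ i, (t i).IsHomogeneous 1)
    (h : idealOfVars ι K ^ s ≤ I ⊔ Ideal.span (Set.range t)) :
    ((Ideal.Quotient.mk P).comp
      (aeval t : MvPolynomial (Fin e) K →ₐ[K] _).toRingHom).IsIntegral := by
  classical
  refine RingHom.isIntegral_of_forall_exists_sum _
    (fun x : ι → Fin s => Ideal.Quotient.mk P (∏ i, X i ^ (x i : ℕ))) fun b => ?_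
  obtain ⟨p, rfl⟩ := Ideal.Quotient.mk_surjective b
  obtain ⟨i, hi, q, hq, hp⟩ := Submodule.mem_sup.1 (mem_sup_boxSpan hI ht h (le_refl p.totalDegree))
  have hi0 : Ideal.Quotient.mk P i = 0 := Ideal.Quotient.eq_zero_iff_mem.2 (hIP hi)
  rw [← hp, map_add, hi0, zero_add]
  clear hi0 hi hp
  induction hq using Submodule.span_induction with
  | mem x hx =>
    obtain ⟨x, rfl⟩ := hx
    refine ⟨Pi.single x.2 (∏ i, X i ^ (x.1 i : ℕ)), ?_⟩
    rw [Finset.sum_eq_single x.2 (fun y _ hy => by simp [hy]) (by simp)]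
    simp
  | zero => exact ⟨0, by simp⟩
  | add x y _ _ hx hy =>
    obtain ⟨f, hf⟩ := hx
    obtain ⟨g, hg⟩ := hy
    exact ⟨f + g, by simp only [map_add, hf, hg, Pi.add_apply, add_mul, Finset.sum_add_distrib]⟩
  | smul a x _ hx =>
    obtain ⟨f, hf⟩ := hx
    refine ⟨fun k => C a * f k, ?_⟩
    rw [smul_eq_C_mul, map_mul, hf, Finset.mul_sum]
    simp [algebraMap_eq, mul_assoc]

/-- Lying over for closed points. -/
lemma exists_mem_zeroLocus_of_isIntegral [IsAlgClosed K] [Finite ι] {T : Type*} [CommRing T]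
    {P : Ideal (MvPolynomial ι K)} (φ : T →+* MvPolynomial ι K)
    (hφ : ((Ideal.Quotient.mk P).comp φ).IsIntegral) {v : ι → K}
    (hsurj : Function.Surjective fun x => eval v (φ x))
    (hv : ∀ x, φ x ∈ P → eval v (φ x) = 0) :
    ∃ w ∈ zeroLocus K P, ∀ x, eval v (φ x) = 0 → eval w (φ x) = 0 := by
  let _ : Algebra T (MvPolynomial ι K ⧸ P) := ((Ideal.Quotient.mk P).comp φ).toAlgebra
  have : Algebra.IsIntegral T (MvPolynomial ι K ⧸ P) := algebraMap_isIntegral_iff.1 hφ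
  have hM := RingHom.ker_isMaximal_of_surjective ((eval v).comp φ) hsurj
  obtain ⟨Q, hQ, hQM⟩ := Ideal.exists_ideal_over_maximal_of_isIntegral
    (S := MvPolynomial ι K ⧸ P) (RingHom.ker ((eval v).comp φ)) fun x hx =>
      hv x (Ideal.Quotient.eq_zero_iff_mem.1 (RingHom.mem_ker.1 hx))
  have hQ' := Ideal.comap_isMaximal_of_surjective (Ideal.Quotient.mk P)
    Ideal.Quotient.mk_surjective (K := Q)
  obtain ⟨w, hw⟩ := (isMaximal_iff_eq_vanishingIdeal_singleton (K := K)).1 hQ'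
  have hmem (p : MvPolynomial ι K) : Ideal.Quotient.mk P p ∈ Q ↔ eval w p = 0 := by
    rw [← Ideal.mem_comap, hw, mem_vanishingIdeal_singleton_iff, aeval_eq_eval]
  refine ⟨w, fun p hp => ?_, fun x hx => ?_⟩
  · rw [aeval_eq_eval]
    exact (hmem p).1 (by rw [Ideal.Quotient.eq_zero_iff_mem.2 hp]; exact Q.zero_mem)
  · have : x ∈ RingHom.ker ((eval v).comp φ) := hx
    rw [← hQM] at this
    exact (hmem _).1 this

end Projection

section Primality

variable {K ι : Type*} [Field K]

lemma exists_prime_forall_aeval_mem {J : Ideal (MvPolynomial ι K)}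
    {e : ℕ} {t : Fin e → MvPolynomial ι K}
    (hJ : ∀ f : MvPolynomial (Fin e) K, aeval t f ∈ J → f = 0) :
    ∃ P : Ideal (MvPolynomial ι K), P.IsPrime ∧ J ≤ P ∧
      ∀ f : MvPolynomial (Fin e) K, aeval t f ∈ P → f = 0 := by
  let S := (nonZeroDivisors (MvPolynomial (Fin e) K)).map (aeval t : MvPolynomial (Fin e) K →ₐ[K] _)
  have hd : Disjoint (J : Set (MvPolynomial ι K)) S := by
    rw [Set.disjoint_left]
    rintro _ hx ⟨f, hf, rfl⟩
    exact nonZeroDivisors.ne_zero hf (hJ f hx)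
  obtain ⟨P, hP, hJP, hPS⟩ := Ideal.exists_le_prime_disjoint J S hd
  refine ⟨P, hP, hJP, fun f hf => ?_⟩
  by_contra h0
  exact Set.disjoint_left.1 hPS hf ⟨f, mem_nonZeroDivisors_of_ne_zero h0, rfl⟩

/-- The points of a closed set lying over a point under an integral projection form a finite set. -/
lemma finite_setOf_mem_zeroLocus [Finite ι] {P : Ideal (MvPolynomial ι K)} {T : Type*} [CommRing T]
    (φ : T →+* MvPolynomial ι K) (hφ : ((Ideal.Quotient.mk P).comp φ).IsIntegral) (v : ι → K) :
    {w ∈ zeroLocus K P | ∀ x, eval w (φ x) = eval v (φ x)}.Finite := by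
  classical
  choose m hm hmz using fun i => hφ (Ideal.Quotient.mk P (X i))
  refine (Set.Finite.pi' fun i =>
    (((m i).map ((eval v).comp φ)).roots.toFinset.finite_toSet)).subset ?_
  rintro w ⟨hwP, hw⟩ i
  have hwv : (eval w).comp φ = (eval v).comp φ := RingHom.ext hw
  have hmem : (m i).eval₂ φ (X i) ∈ P := by
    rw [← Ideal.Quotient.eq_zero_iff_mem, Polynomial.hom_eval₂]
    exact hmz i
  have h0 := hwP _ hmem
  rw [aeval_eq_eval] at h0
  have h1 : eval w ((m i).eval₂ φ (X i)) = 0 := h0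
  rw [Polynomial.hom_eval₂, hwv, eval_X] at h1
  simp only [Finset.mem_coe, Multiset.mem_toFinset]
  rw [Polynomial.mem_roots ((hm i).map _).ne_zero, Polynomial.IsRoot, Polynomial.eval_map]
  exact h1

/-- A linear form separating a point from finitely many others. -/
lemma exists_isHomogeneous_one_eval_ne [Infinite K] [Fintype ι] {W : Set (ι → K)} (hW : W.Finite)
    {v : ι → K} (hv : v ∉ W) :
    ∃ l : MvPolynomial ι K, l.IsHomogeneous 1 ∧ ∀ w ∈ W, eval w l ≠ eval v l := by
  classical
  let Q : MvPolynomial ι K := ∏ w ∈ hW.toFinset, ∑ i, C (w i - v i) * X i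
  have hQ : Q ≠ 0 := by
    rw [Finset.prod_ne_zero_iff]
    intro w hw h0
    obtain ⟨i, hi⟩ := Function.ne_iff.1 (show w ≠ v from fun h => hv (h ▸ hW.mem_toFinset.1 hw))
    have := congrArg (eval (Pi.single i 1)) h0
    simp [Pi.single_apply] at this
    exact hi (sub_eq_zero.1 this)
  obtain ⟨b, hb⟩ : ∃ b, eval b Q ≠ 0 := by
    by_contra! h
    exact hQ (MvPolynomial.funext fun x => by simpa using h x)
  refine ⟨∑ i, C (b i) * X i, ?_, fun w hw h => ?_⟩
  · exact IsHomogeneous.sum _ _ _ fun i _ => by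
      simpa using (isHomogeneous_C ι (b i)).mul (isHomogeneous_X K i)
  · rw [map_prod, Finset.prod_ne_zero_iff] at hb
    refine hb w (hW.mem_toFinset.2 hw) ?_
    rw [← sub_eq_zero] at h
    simpa [sub_mul, Finset.sum_sub_distrib, mul_comm (b _)] using h

/-- The polynomial relations over an integrally closed subring satisfied by an integral element
are the multiples of a monic polynomial. -/
lemma exists_monic_forall_dvd_iff {A B : Type*} [CommRing A] [IsDomain A] [IsIntegrallyClosed A]
    [CommRing B] [IsDomain B] (φ : A →+* B) (hφ : Function.Injective φ) (hi : φ.IsIntegral)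
    (b : B) :
    ∃ G : Polynomial A, G.Monic ∧ G ≠ 1 ∧ ∀ H : Polynomial A, H.eval₂ φ b = 0 ↔ G ∣ H := by
  let _ : Algebra A B := φ.toAlgebra
  have : FaithfulSMul A B := (faithfulSMul_iff_algebraMap_injective A B).2 hφ
  have hb : IsIntegral A b := hi b
  exact ⟨minpoly A b, minpoly.monic hb, minpoly.ne_one A b, fun H =>
    minpoly.isIntegrallyClosed_dvd_iff hb H⟩

lemma eval₂_finSuccEquiv {e : ℕ} (t : Fin e → MvPolynomial ι K) (l : MvPolynomial ι K)
    (χ : MvPolynomial (Fin (e + 1)) K) :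
    (finSuccEquiv K e χ).eval₂ (aeval t : MvPolynomial (Fin e) K →ₐ[K] _).toRingHom l =
      aeval (Fin.cons l t : Fin (e + 1) → MvPolynomial ι K) χ := by
  have : (Polynomial.eval₂RingHom (aeval t : MvPolynomial (Fin e) K →ₐ[K] _).toRingHom l).comp
      (finSuccEquiv K e : MvPolynomial (Fin (e + 1)) K →+* _) =
      (aeval (Fin.cons l t : Fin (e + 1) → MvPolynomial ι K)).toRingHom := by
    refine MvPolynomial.ringHom_ext (fun r => ?_) fun i => ?_
    · simp [finSuccEquiv_apply]
    · refine Fin.cases ?_ (fun i => ?_) i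
      · simp [finSuccEquiv_X_zero]
      · simp [finSuccEquiv_X_succ]
  exact congr($this χ)

/-- If the vanishing ideal of a cone is not prime, then this is witnessed by two polynomials
whose degree is bounded in terms of the dimension and the complexity of a finite projection. -/
theorem exists_mul_eq_zero_of_not_isPrime [IsAlgClosed K] [Fintype ι]
    {I : Ideal (MvPolynomial ι K)} (hI : ∀ p ∈ I, ∀ k, homogeneousComponent k p ∈ I)
    (h0 : 0 ∈ zeroLocus K I) (hcone : ∀ y ∈ zeroLocus K I, ∀ a : K, a • y ∈ zeroLocus K I)
    {e s : ℕ} (hmin : ∀ e' < e, ¬ HasFiniteProjection (zeroLocus K I) e')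
    {t : Fin e → MvPolynomial ι K} (ht : ∀ i, (t i).IsHomogeneous 1)
    (hs : idealOfVars ι K ^ s ≤ I ⊔ Ideal.span (Set.range t))
    (hJ : ¬ (vanishingIdeal K (zeroLocus K I)).IsPrime) :
    ∃ g h : MvPolynomial ι K, g.totalDegree ≤ relationDegree e (s ^ Fintype.card ι) ∧
      h.totalDegree ≤ relationDegree e (s ^ Fintype.card ι) ∧
      (∀ y ∈ zeroLocus K I, eval y g * eval y h = 0) ∧
      (∃ y ∈ zeroLocus K I, eval y g ≠ 0) ∧ (∃ y ∈ zeroLocus K I, eval y h ≠ 0) := by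
  have hmemJ (p : MvPolynomial ι K) :
      p ∈ vanishingIdeal K (zeroLocus K I) ↔ ∀ y ∈ zeroLocus K I, eval y p = 0 := by
    simp only [mem_vanishingIdeal_iff, aeval_eq_eval]
  have hIJ : I ≤ vanishingIdeal K (zeroLocus K I) := fun p hp => (hmemJ p).2 fun y hy => by
    simpa [aeval_eq_eval] using hy p hp
  have htC : ∀ y ∈ zeroLocus K I, (∀ i, eval y (t i) = 0) → y = 0 := by
    intro y hy hyt
    have hle : I ⊔ Ideal.span (Set.range t) ≤ RingHom.ker (eval y) := by
      refine sup_le (fun p hp => (hmemJ p).1 (hIJ hp) y hy) (Ideal.span_le.2 ?_)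
      rintro _ ⟨i, rfl⟩
      exact hyt i
    funext i
    have hX : X i ∈ idealOfVars ι K := Ideal.subset_span ⟨i, rfl⟩
    have := hle (hs (Ideal.pow_mem_pow hX s))
    rw [RingHom.mem_ker, map_pow, eval_X] at this
    exact eq_zero_of_pow_eq_zero this
  set J := vanishingIdeal K (zeroLocus K I)
  obtain ⟨P, hP, hJP, hPt⟩ := exists_prime_forall_aeval_mem (J := J) (t := t) fun f hf => by
    by_contra hf0
    obtain ⟨y, hy, hne⟩ := exists_eval_aeval_ne_zero h0 hcone hmin ht htC hf0
    exact hne ((hmemJ _).1 hf y hy)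
  have hne : J ≠ P := fun h => hJ (h ▸ hP)
  obtain ⟨p, hpP, hpJ⟩ := SetLike.exists_of_lt (lt_of_le_of_ne hJP hne)
  obtain ⟨v, hv, hpv⟩ : ∃ v ∈ zeroLocus K I, eval v p ≠ 0 := by
    by_contra! h
    exact hpJ ((hmemJ p).2 h)
  let φ : MvPolynomial (Fin e) K →+* MvPolynomial ι K :=
    (aeval t : MvPolynomial (Fin e) K →ₐ[K] _).toRingHom
  have hφ := isIntegral_quotient_comp_aeval hI (hIJ.trans hJP) ht hs
  obtain ⟨l, hl, hlv⟩ := exists_isHomogeneous_one_eval_ne (finite_setOf_mem_zeroLocus φ hφ v)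
    (v := v) fun h => hpv (by simpa [aeval_eq_eval] using h.1 p hpP)
  obtain ⟨χ, hχ0, hχd, hχ⟩ := exists_relation hI ht hs hl
  let ψ : Polynomial (MvPolynomial (Fin e) K) →+* MvPolynomial ι K := Polynomial.eval₂RingHom φ l
  have hψ (f) : ψ (finSuccEquiv K e f) = aeval (Fin.cons l t : Fin (e + 1) → MvPolynomial ι K) f :=
    eval₂_finSuccEquiv t l f
  have hinj : Function.Injective ((Ideal.Quotient.mk P).comp φ) := by
    rw [injective_iff_map_eq_zero]
    exact fun f hf => hPt f (Ideal.Quotient.eq_zero_iff_mem.1 hf)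
  obtain ⟨G, hG, hG1, hGdvd⟩ := exists_monic_forall_dvd_iff _ hinj hφ (Ideal.Quotient.mk P l)
  have hGψ (H) : ψ H ∈ P ↔ G ∣ H := by
    rw [← hGdvd, ← Ideal.Quotient.eq_zero_iff_mem]
    change Ideal.Quotient.mk P (H.eval₂ φ l) = 0 ↔ _
    rw [Polynomial.hom_eval₂]
  have hχ0' : finSuccEquiv K e χ ≠ 0 := (map_ne_zero_iff _ (finSuccEquiv K e).injective).2 hχ0
  have hχP : G ∣ finSuccEquiv K e χ := (hGψ _).1 (hψ χ ▸ hJP (hIJ hχ))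
  have hGdeg : 0 < G.degree := hG.degree_pos.2 hG1
  obtain ⟨H, hH, hGH⟩ := (Polynomial.finiteMultiplicity_of_degree_pos_of_monic hGdeg hG
    hχ0').exists_eq_pow_mul_and_not_dvd
  set a := multiplicity G (finSuccEquiv K e χ)
  have ha : a ≠ 0 := by
    intro ha
    rw [ha, pow_zero, one_mul] at hH
    exact hGH (hH ▸ hχP)
  have hψH : ψ H ∉ P := fun h => hGH ((hGψ H).1 h)
  have hu (i) : ((Fin.cons l t : Fin (e + 1) → MvPolynomial ι K) i).totalDegree ≤ 1 := by
    refine Fin.cases ?_ (fun i => ?_) i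
    · exact hl.totalDegree_le
    · exact (ht i).totalDegree_le
  have hdeg (f : Polynomial (MvPolynomial (Fin e) K)) :
      (ψ f).totalDegree ≤ ((finSuccEquiv K e).symm f).totalDegree := by
    rw [← (finSuccEquiv K e).apply_symm_apply f, hψ, (finSuccEquiv K e).apply_symm_apply f]
    exact totalDegree_aeval_le hu _
  have hχeq : χ = (finSuccEquiv K e).symm G ^ a * (finSuccEquiv K e).symm H := by
    rw [← map_pow, ← map_mul, ← hH, AlgEquiv.symm_apply_apply]
  refine ⟨ψ G, ψ H, ?_, ?_, fun y hy => ?_, ⟨v, hv, fun hGv => ?_⟩, ?_⟩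
  · exact (hdeg G).trans ((totalDegree_le_of_dvd_of_isDomain
      (hχeq ▸ (dvd_pow_self _ ha).mul_right _) hχ0).trans hχd)
  · exact (hdeg H).trans ((totalDegree_le_of_dvd_of_isDomain
      (hχeq ▸ dvd_mul_left _ _) hχ0).trans hχd)
  · have := (hmemJ _).1 (hIJ hχ) y hy
    rw [← hψ, hH, map_mul, map_pow, map_mul, map_pow] at this
    rcases mul_eq_zero.1 this with h | h
    · rw [eq_zero_of_pow_eq_zero h, zero_mul]
    · rw [h, mul_zero]
  · have hψi : ((Ideal.Quotient.mk P).comp ψ).IsIntegral := by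
      refine RingHom.IsIntegral.tower_top Polynomial.C _ ?_
      have hcomp : ((Ideal.Quotient.mk P).comp ψ).comp Polynomial.C =
          (Ideal.Quotient.mk P).comp φ := RingHom.ext fun x => by simp [ψ]
      exact hcomp ▸ hφ
    have hψC (x) : ψ (Polynomial.C (C x)) = C x := by simp [ψ, φ, algebraMap_eq]
    obtain ⟨w, hwP, hw⟩ := exists_mem_zeroLocus_of_isIntegral ψ hψi (v := v)
      (fun x => ⟨Polynomial.C (C x), by simp [hψC]⟩) fun x hx => by
        obtain ⟨q, rfl⟩ := (hGψ x).1 hx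
        rw [map_mul, map_mul, hGv, zero_mul]
    have hw' (x) : eval w (ψ x) = eval v (ψ x) := by
      have := hw (x - Polynomial.C (C (eval v (ψ x)))) (by simp [hψC])
      rwa [map_sub, map_sub, hψC, eval_C, sub_eq_zero] at this
    refine hlv w ⟨hwP, fun x => ?_⟩ ?_
    · simpa [ψ] using hw' (Polynomial.C x)
    · simpa [ψ] using hw' Polynomial.X
  · by_contra! h
    exact hψH (hJP ((hmemJ _).2 h))

end Primality

section Uniform

variable {K ι κ σ : Type*} [Field K]

lemma mem_zeroLocus_span_range_iff {p : κ → MvPolynomial ι K} {y : ι → K} :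
    y ∈ zeroLocus K (Ideal.span (Set.range p)) ↔ ∀ j, eval y (p j) = 0 := by
  refine ⟨fun h j => ?_, fun h q hq => ?_⟩
  · simpa [aeval_eq_eval] using h (p j) (Ideal.subset_span ⟨j, rfl⟩)
  · have hle : Ideal.span (Set.range p) ≤ RingHom.ker (eval y) := by
      rw [Ideal.span_le]
      rintro _ ⟨j, rfl⟩
      exact h j
    rw [aeval_eq_eval]
    exact hle hq

/-- A neighbourhood assignment on a subset of affine space has a finite subcover. -/
lemma exists_finset_forall_exists_eval_ne_zero [Finite σ] (S : Set (σ → K))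
    (f : (σ → K) → MvPolynomial σ K) (hf : ∀ c ∈ S, eval c (f c) ≠ 0) :
    ∃ T : Finset (σ → K), ∀ c ∈ S, ∃ c' ∈ T, c' ∈ S ∧ eval c (f c') ≠ 0 := by
  classical
  obtain ⟨T, hTS, hT⟩ := Submodule.fg_span_iff_fg_span_finset_subset (R := MvPolynomial σ K)
    (f '' S) |>.1 (IsNoetherian.noetherian _)
  obtain ⟨T', hT'S, rfl⟩ := Finset.subset_set_image_iff.1 hTS
  refine ⟨T', fun c hc => ?_⟩
  by_contra! h
  refine hf c hc ?_
  have hle : Ideal.span (f '' S) ≤ RingHom.ker (eval c) := by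
    change Submodule.span _ _ ≤ _
    rw [hT, ← Ideal.span, Ideal.span_le]
    intro q hq
    obtain ⟨c', hc', rfl⟩ := Finset.mem_image.1 hq
    exact h c' hc' (hT'S hc')
  exact hle (Ideal.subset_span ⟨c, hc, rfl⟩)

/-- In a family of cones given by homogeneous equations, the failure of primality of the vanishing
ideal is witnessed in a degree that does not depend on the member of the family. -/
theorem exists_degree_bound_forall_not_isPrime [IsAlgClosed K] [Fintype ι] [Fintype κ] [Finite σ]
    {d : κ → ℕ} (hd : ∀ j, d j ≠ 0) {F : κ → MvPolynomial ι (MvPolynomial σ K)}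
    (hF : ∀ j, (F j).IsHomogeneous (d j)) :
    ∃ D, ∀ c : σ → K, ∀ Z : Set (ι → K), Z = {y | ∀ j, eval y (map (eval c) (F j)) = 0} →
      ¬ (vanishingIdeal K Z).IsPrime → ∃ g h : MvPolynomial ι K,
        g.totalDegree ≤ D ∧ h.totalDegree ≤ D ∧ (∀ y ∈ Z, eval y g * eval y h = 0) ∧
        (∃ y ∈ Z, eval y g ≠ 0) ∧ (∃ y ∈ Z, eval y h ≠ 0) := by
  classical
  let I (c : σ → K) : Ideal (MvPolynomial ι K) :=
    Ideal.span (Set.range fun j => map (eval c) (F j))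
  have hFc (c : σ → K) (j) : (map (eval c) (F j)).IsHomogeneous (d j) := (hF j).map _
  have hI (c) : ∀ p ∈ I c, ∀ k, homogeneousComponent k p ∈ I c := fun p hp k =>
    homogeneousComponent_mem_span_range (hFc c) hp k
  have h0 (c) : 0 ∈ zeroLocus K (I c) := mem_zeroLocus_span_range_iff.2 fun j => by
    have := (hFc c j).eval_smul 0 0
    rwa [zero_smul, zero_pow (hd j), zero_mul] at this
  have hcone (c) : ∀ y ∈ zeroLocus K (I c), ∀ a : K, a • y ∈ zeroLocus K (I c) := by
    intro y hy a
    rw [mem_zeroLocus_span_range_iff] at hy ⊢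
    intro j
    rw [(hFc c j).eval_smul, hy j, mul_zero]
  have hex (c) : ∃ e, HasFiniteProjection (zeroLocus K (I c)) e := ⟨_, hasFiniteProjection_card _⟩
  let e (c) : ℕ := Nat.find (hex c)
  choose t ht htC using fun c => Nat.find_spec (hex c)
  have hloc (c) : ∃ f : MvPolynomial σ K, eval c f ≠ 0 ∧ ∃ s, ∀ c', eval c' f ≠ 0 →
      idealOfVars ι K ^ s ≤ I c' ⊔ Ideal.span (Set.range (t c)) := by
    let F' : κ ⊕ Fin (e c) → MvPolynomial ι (MvPolynomial σ K) :=
      Sum.elim F fun i => map C (t c i)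
    have hF' : ∀ j, (F' j).IsHomogeneous (Sum.elim d (fun _ => 1) j) := by
      rintro (j | j)
      · exact hF j
      · exact (ht c j).map _
    have hspan (c') : Ideal.span (Set.range fun j => map (eval c') (F' j)) =
        I c' ⊔ Ideal.span (Set.range (t c)) := by
      have hid : (eval c').comp (C : K →+* MvPolynomial σ K) = RingHom.id K := by ext; simp
      rw [← Ideal.span_union, ← Set.Sum.elim_range]
      congr 2
      ext1 j
      rcases j with j | j
      · rfl
      · simp [F', map_map, hid, MvPolynomial.map_id]
    obtain ⟨s, hs⟩ := exists_idealOfVars_pow_le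
      (I := I c ⊔ Ideal.span (Set.range (t c))) fun y hy =>
        htC c y (fun p hp => hy p (Ideal.mem_sup_left hp)) fun i => by
          simpa [aeval_eq_eval] using
            hy (t c i) (Ideal.mem_sup_right (Ideal.subset_span ⟨i, rfl⟩))
    rw [← hspan] at hs
    obtain ⟨f, hf, hfs⟩ := exists_eval_ne_zero_idealOfVars_pow_le hF' c hs
    exact ⟨f, hf, s, fun c' hc' => hspan c' ▸ hfs c' hc'⟩
  choose f hf s hs using hloc
  choose T hT using fun n => exists_finset_forall_exists_eval_ne_zero {c | e c = n} f
    fun c _ => hf c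
  refine ⟨(Finset.range (Fintype.card ι + 1)).sup fun n => (T n).sup fun c =>
    relationDegree (e c) (s c ^ Fintype.card ι), ?_⟩
  rintro c _ rfl hZ
  have hZI : {y | ∀ j, eval y (map (eval c) (F j)) = 0} = zeroLocus K (I c) :=
    Set.ext fun y => mem_zeroLocus_span_range_iff.symm
  rw [hZI] at hZ
  obtain ⟨c', hc'T, hc', hne⟩ := hT (e c) c rfl
  have hmin : ∀ e' < e c', ¬ HasFiniteProjection (zeroLocus K (I c)) e' := fun e' he' =>
    Nat.find_min (hex c) (he'.trans_eq hc')
  obtain ⟨g, h, hg, hh, H⟩ := exists_mul_eq_zero_of_not_isPrime (hI c) (h0 c) (hcone c) hmin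
    (ht c') (hs c' c hne) hZ
  have hle : relationDegree (e c') (s c' ^ Fintype.card ι) ≤
      (Finset.range (Fintype.card ι + 1)).sup fun n => (T n).sup fun c =>
        relationDegree (e c) (s c ^ Fintype.card ι) := by
    refine le_trans ?_ (Finset.le_sup (b := e c) (Finset.mem_range.2 (Nat.lt_succ_of_le
      (Nat.find_min' (hex c) (hasFiniteProjection_card _)))))
    exact Finset.le_sup (f := fun c => relationDegree (e c) (s c ^ Fintype.card ι)) hc'T
  rw [hZI]
  exact ⟨g, h, hg.trans hle, hh.trans hle, H⟩

end Uniform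

section Projective

variable {K ι κ : Type*} [Field K]

lemma exists_polynomial_eval_smul (g : MvPolynomial ι K) (y : ι → K) :
    ∃ p : Polynomial K, (∀ k, p.coeff k = eval y (homogeneousComponent k g)) ∧
      ∀ a, p.eval a = eval (a • y) g := by
  classical
  refine ⟨∑ k ∈ Finset.range (g.totalDegree + 1),
    Polynomial.monomial k (eval y (homogeneousComponent k g)), fun k => ?_, fun a => ?_⟩
  · rw [Polynomial.finsetSum_coeff]
    simp only [Polynomial.coeff_monomial, Finset.sum_ite_eq', Finset.mem_range]
    split_ifs with hk
    · rfl
    · rw [homogeneousComponent_eq_zero _ _ (by omega), map_zero]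
  · conv_rhs => rw [← sum_homogeneousComponent g]
    rw [Polynomial.eval_finsetSum, map_sum]
    refine Finset.sum_congr rfl fun k _ => ?_
    rw [Polynomial.eval_monomial, (homogeneousComponent_isHomogeneous k g).eval_smul, mul_comm]

lemma eval_rep_mk_eq_zero_iff {d : ℕ} {f : MvPolynomial ι K} (hf : f.IsHomogeneous d) {y : ι → K}
    (hy : y ≠ 0) : eval (Projectivization.mk K y hy).rep f = 0 ↔ eval y f = 0 := by
  obtain ⟨a, ha⟩ := Projectivization.exists_smul_eq_mk_rep K y hy
  rw [← ha, Units.smul_def, hf.eval_smul, mul_eq_zero, or_iff_right (pow_ne_zero _ a.ne_zero)]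

lemma isTopologicalBasis_projZariskiTopology (n : ℕ) :
    @TopologicalSpace.IsTopologicalBasis _ (projZariskiTopology K n)
      {U | ∃ (d : ℕ) (f : MvPolynomial (Fin (n + 1)) K), f.IsHomogeneous d ∧
        U = {p | eval p.rep f ≠ 0}} := by
  let _ := projZariskiTopology K n
  refine ⟨?_, ?_, rfl⟩
  · rintro _ ⟨d, f, hf, rfl⟩ _ ⟨e, g, hg, rfl⟩ p ⟨hpf, hpg⟩
    exact ⟨_, ⟨d + e, f * g, hf.mul hg, rfl⟩, by simpa using ⟨hpf, hpg⟩, fun q hq => by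
      simpa [not_or] using hq⟩
  · rw [Set.eq_univ_iff_forall]
    exact fun p => ⟨_, ⟨0, 1, isHomogeneous_one _ _, rfl⟩, by simp⟩

/-- A projective closed set is irreducible if and only if it is nonempty and the vanishing ideal of
its affine cone is prime. -/
theorem isIrreducible_iff_isPrime_vanishingIdeal [Infinite K] {n : ℕ} {d : κ → ℕ}
    {F : κ → MvPolynomial (Fin (n + 1)) K}
    (hF : ∀ j, (F j).IsHomogeneous (d j)) :
    @IsIrreducible _ (projZariskiTopology K n)
      {p : Projectivization K (Fin (n + 1) → K) | ∀ j, eval p.rep (F j) = 0} ↔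
    (∃ y : Fin (n + 1) → K, y ≠ 0 ∧ ∀ j, eval y (F j) = 0) ∧
      (vanishingIdeal K {y : Fin (n + 1) → K | ∀ j, eval y (F j) = 0}).IsPrime := by
  let _ := projZariskiTopology K n
  have hB := isTopologicalBasis_projZariskiTopology (K := K) n
  set Z := {y : Fin (n + 1) → K | ∀ j, eval y (F j) = 0}
  have hmemJ (p : MvPolynomial (Fin (n + 1)) K) :
      p ∈ vanishingIdeal K Z ↔ ∀ y ∈ Z, eval y p = 0 := by
    simp only [mem_vanishingIdeal_iff, aeval_eq_eval]
  have hcone : ∀ y ∈ Z, ∀ a : K, a • y ∈ Z := fun y hy a j => by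
    rw [(hF j).eval_smul, hy j, mul_zero]
  have hmk {y : Fin (n + 1) → K} (hy0 : y ≠ 0) (hy : y ∈ Z) (j) :
      eval (Projectivization.mk K y hy0).rep (F j) = 0 :=
    (eval_rep_mk_eq_zero_iff (hF j) hy0).2 (hy j)
  constructor
  · rintro ⟨⟨q, hq⟩, hirr⟩
    refine ⟨⟨q.rep, q.rep_nonzero, hq⟩, ⟨?_, ?_⟩⟩
    · rw [Ideal.ne_top_iff_one, hmemJ]
      intro h
      simpa using h q.rep hq
    · intro g h hgh
      by_contra! hnot
      have key (g : MvPolynomial (Fin (n + 1)) K) (hg : g ∉ vanishingIdeal K Z) :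
          ∃ i, ∃ y ∈ Z, y ≠ 0 ∧ eval y (homogeneousComponent i g) ≠ 0 := by
        rw [hmemJ] at hg
        push Not at hg
        obtain ⟨y, hy, hgy⟩ := hg
        rw [← sum_homogeneousComponent g, map_sum] at hgy
        obtain ⟨i, -, hi⟩ := Finset.exists_ne_zero_of_sum_ne_zero hgy
        by_cases hy0 : y = 0
        · refine ⟨i, q.rep, hq, q.rep_nonzero, fun h0 => hi ?_⟩
          rw [hy0, ← zero_smul K q.rep, (homogeneousComponent_isHomogeneous i g).eval_smul, h0,
            mul_zero]
        · exact ⟨i, y, hy, hy0, hi⟩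
      obtain ⟨i, y, hy, hy0, hi⟩ := key g hnot.1
      obtain ⟨j, z, hz, hz0, hj⟩ := key h hnot.2
      have hgi := homogeneousComponent_isHomogeneous i g
      have hhj := homogeneousComponent_isHomogeneous j h
      obtain ⟨p, hp, hpi, hpj⟩ := hirr _ _ (hB.isOpen ⟨i, _, hgi, rfl⟩)
        (hB.isOpen ⟨j, _, hhj, rfl⟩)
        ⟨Projectivization.mk K y hy0, hmk hy0 hy, (eval_rep_mk_eq_zero_iff hgi hy0).not.2 hi⟩
        ⟨Projectivization.mk K z hz0, hmk hz0 hz, (eval_rep_mk_eq_zero_iff hhj hz0).not.2 hj⟩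
      obtain ⟨a, ha, hag⟩ := exists_polynomial_eval_smul g p.rep
      obtain ⟨b, hb, hbh⟩ := exists_polynomial_eval_smul h p.rep
      have ha0 : a ≠ 0 := fun h0 => hpi (by rw [← ha, h0, Polynomial.coeff_zero])
      have hb0 : b ≠ 0 := fun h0 => hpj (by rw [← hb, h0, Polynomial.coeff_zero])
      refine mul_ne_zero ha0 hb0 (Polynomial.funext fun c => ?_)
      rw [Polynomial.eval_mul, hag, hbh, ← map_mul, Polynomial.eval_zero]
      exact (hmemJ _).1 hgh _ (hcone _ hp c)
  · rintro ⟨⟨y, hy0, hy⟩, hprime⟩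
    refine ⟨⟨_, hmk hy0 hy⟩, ?_⟩
    rintro u v hu hv ⟨q₁, hq₁, hqu⟩ ⟨q₂, hq₂, hqv⟩
    obtain ⟨_, ⟨d₁, f₁, hf₁, rfl⟩, hqf₁, hfu⟩ := hB.exists_subset_of_mem_open hqu hu
    obtain ⟨_, ⟨d₂, f₂, hf₂, rfl⟩, hqf₂, hfv⟩ := hB.exists_subset_of_mem_open hqv hv
    by_contra hempty
    have hmul (p : Projectivization K (Fin (n + 1) → K)) (hp : p.rep ∈ Z) :
        eval p.rep (f₁ * f₂) = 0 := by
      by_contra hne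
      rw [map_mul, mul_eq_zero, not_or] at hne
      exact hempty ⟨p, hp, hfu hne.1, hfv hne.2⟩
    have hmem : f₁ * f₂ ∈ vanishingIdeal K Z := by
      rw [hmemJ]
      intro z hz
      by_cases hz0 : z = 0
      · rw [hz0, ← zero_smul K q₁.rep, (hf₁.mul hf₂).eval_smul, hmul _ hq₁, mul_zero]
      · exact (eval_rep_mk_eq_zero_iff (hf₁.mul hf₂) hz0).1 (hmul _ (hmk hz0 hz))
    rcases hprime.mem_or_mem hmem with h | h
    · exact hqf₁ ((hmemJ _).1 h _ hq₁)
    · exact hqf₂ ((hmemJ _).1 h _ hq₂)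

end Projective

section Definability

variable {K ι κ ρ : Type*} [Field K]

lemma eval_eval₂_rename_inl (x : ρ → K) (y : ι → K) (u : MvPolynomial ι (MvPolynomial ρ K)) :
    eval (Sum.elim x y) (eval₂ (rename Sum.inl : MvPolynomial ρ K →ₐ[K] _).toRingHom
      (fun i => X (Sum.inr i)) u) = eval y (map (eval x) u) := by
  have : (eval (Sum.elim x y)).comp (eval₂Hom (rename Sum.inl : MvPolynomial ρ K →ₐ[K] _).toRingHom
      (fun i => X (Sum.inr i))) = (eval y).comp (map (eval x)) := by
    refine ringHom_ext (fun r => ?_) fun i => ?_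
    · simp [eval_rename, Function.comp_def]
    · simp
  exact congr($this u)

lemma map_eval_map_rename {α : Type*} (f : α → ρ) (x : ρ → K)
    (u : MvPolynomial ι (MvPolynomial α K)) :
    map (eval x) (map (rename f : MvPolynomial α K →ₐ[K] MvPolynomial ρ K).toRingHom u) =
      map (eval (x ∘ f)) u := by
  rw [map_map]
  congr 1
  ext <;> simp

/-- The parameters for which a polynomial does not vanish identically on a closed set form a
constructible set. -/
lemma isPointConstructible_exists_eval_ne_zero [IsAlgClosed K] [Finite ι] [Finite κ] [Finite ρ]
    (F : κ → MvPolynomial ι (MvPolynomial ρ K)) (u : MvPolynomial ι (MvPolynomial ρ K)) :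
    IsPointConstructible {x : ρ → K | ∃ y : ι → K,
      (∀ j, eval y (map (eval x) (F j)) = 0) ∧ eval y (map (eval x) u) ≠ 0} := by
  convert ((IsPointConstructible.iInter fun j => .eval_eq_zero (eval₂
      (rename Sum.inl : MvPolynomial ρ K →ₐ[K] _).toRingHom (fun i => X (Sum.inr i)) (F j))).inter
    (.eval_ne_zero (eval₂ (rename Sum.inl : MvPolynomial ρ K →ₐ[K] _).toRingHom
      (fun i => X (Sum.inr i)) u))).exists_sumElim with x y
  simp only [Set.mem_inter_iff, Set.mem_iInter, Set.mem_ofPred_eq, eval_eval₂_rename_inl]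

/-- The general polynomial whose exponents are bounded by `D`, with indeterminate coefficients. -/
noncomputable def genericPolynomial (K ι : Type*) [Field K] [Fintype ι] [DecidableEq ι] (D : ℕ) :
    MvPolynomial ι (MvPolynomial (ι → Fin (D + 1)) K) :=
  ∑ a : ι → Fin (D + 1), monomial (Finsupp.equivFunOnFinite.symm fun i => (a i : ℕ)) (X a)

lemma exists_map_eval_genericPolynomial_eq [Fintype ι] [DecidableEq ι] {D : ℕ}
    {g : MvPolynomial ι K} (hg : g.totalDegree ≤ D) :
    ∃ b, map (eval b) (genericPolynomial K ι D) = g := by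
  refine ⟨fun a => coeff (Finsupp.equivFunOnFinite.symm fun i => (a i : ℕ)) g, ?_⟩
  ext m
  simp only [genericPolynomial, map_sum, map_monomial, eval_X, coeff_sum, coeff_monomial]
  by_cases hm : ∀ i, m i < D + 1
  · rw [Finset.sum_eq_single fun i => ⟨m i, hm i⟩]
    · have : (Finsupp.equivFunOnFinite.symm fun i => m i) = m := by ext; rfl
      simp [this]
    · intro a _ ha
      rw [if_neg]
      rintro rfl
      exact ha rfl
    · simp
  · push Not at hm
    obtain ⟨i, hi⟩ := hm
    rw [Finset.sum_eq_zero, coeff_eq_zero_of_totalDegree_lt]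
    · have h := Finsupp.le_degree i m
      rw [Finsupp.degree_apply] at h
      omega
    · intro a _
      rw [if_neg]
      rintro rfl
      have := (a i).2
      simp at hi
      omega

/-- In a family of cones given by homogeneous equations, the condition that the cone is nontrivial
and has prime vanishing ideal is constructible. -/
theorem isPointConstructible_isPrime_vanishingIdeal [IsAlgClosed K] [Finite ι] [Finite κ]
    [Finite ρ] {d : κ → ℕ} (hd : ∀ j, d j ≠ 0) {F : κ → MvPolynomial ι (MvPolynomial ρ K)}
    (hF : ∀ j, (F j).IsHomogeneous (d j)) :
    IsPointConstructible {c : ρ → K |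
      (∃ y : ι → K, y ≠ 0 ∧ ∀ j, eval y (map (eval c) (F j)) = 0) ∧
      (vanishingIdeal K {y : ι → K | ∀ j, eval y (map (eval c) (F j)) = 0}).IsPrime} := by
  classical
  let _ := Fintype.ofFinite ι
  let _ := Fintype.ofFinite κ
  obtain ⟨D, hD⟩ := exists_degree_bound_forall_not_isPrime hd hF
  let α := ι → Fin (D + 1)
  let F' (j) : MvPolynomial ι (MvPolynomial (ρ ⊕ (α ⊕ α)) K) :=
    map (rename Sum.inl : MvPolynomial ρ K →ₐ[K] _).toRingHom (F j)
  let g : MvPolynomial ι (MvPolynomial (ρ ⊕ (α ⊕ α)) K) :=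
    map (rename (Sum.inr ∘ Sum.inl) : MvPolynomial α K →ₐ[K] _).toRingHom (genericPolynomial K ι D)
  let h : MvPolynomial ι (MvPolynomial (ρ ⊕ (α ⊕ α)) K) :=
    map (rename (Sum.inr ∘ Sum.inr) : MvPolynomial α K →ₐ[K] _).toRingHom (genericPolynomial K ι D)
  have h1 : IsPointConstructible {c : ρ → K |
      ∃ y : ι → K, y ≠ 0 ∧ ∀ j, eval y (map (eval c) (F j)) = 0} := by
    convert (IsPointConstructible.iInter fun i =>
      (isPointConstructible_exists_eval_ne_zero F (X i)).compl).compl using 1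
    ext c
    simp only [Set.mem_compl_iff, Set.mem_iInter, Set.mem_ofPred_eq, not_forall, not_not, map_X,
      eval_X, Function.ne_iff, Pi.zero_apply]
    constructor
    · rintro ⟨y, ⟨i, hi⟩, hy⟩
      exact ⟨i, y, hy, hi⟩
    · rintro ⟨i, y, hy, hi⟩
      exact ⟨y, ⟨i, hi⟩, hy⟩
  have h2 := (((isPointConstructible_exists_eval_ne_zero F' g).inter
    (isPointConstructible_exists_eval_ne_zero F' h)).inter
    (isPointConstructible_exists_eval_ne_zero F' (g * h)).compl).exists_sumElim.compl
  convert h1.inter h2 using 1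
  ext c
  simp only [Set.mem_inter_iff, Set.mem_ofPred_eq, and_congr_right_iff]
  intro _
  rw [Set.mem_compl_iff, ← not_iff_not, not_not]
  have hmemJ (p : MvPolynomial ι K) :
      p ∈ vanishingIdeal K {y : ι → K | ∀ j, eval y (map (eval c) (F j)) = 0} ↔
        ∀ y, (∀ j, eval y (map (eval c) (F j)) = 0) → eval y p = 0 := by
    simp only [mem_vanishingIdeal_iff, aeval_eq_eval, Set.mem_ofPred_eq]
  constructor
  · intro hnot
    obtain ⟨p, q, hp, hq, hpq, hpy, hqy⟩ := hD c _ rfl hnot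
    obtain ⟨a, rfl⟩ := exists_map_eval_genericPolynomial_eq hp
    obtain ⟨b, rfl⟩ := exists_map_eval_genericPolynomial_eq hq
    refine ⟨Sum.elim a b, ?_⟩
    simp only [F', g, h, Set.mem_compl_iff, Set.mem_ofPred_eq, map_mul,
      map_eval_map_rename, ← Function.comp_assoc, Sum.elim_comp_inl, Sum.elim_comp_inr, not_exists,
      not_and, not_not]
    exact ⟨⟨hpy, hqy⟩, hpq⟩
  · rintro ⟨b, ⟨⟨y, hy, hyg⟩, ⟨z, hz, hzh⟩⟩, hgh⟩ hprime
    simp only [F', Set.mem_compl_iff, Set.mem_ofPred_eq, map_eval_map_rename, Sum.elim_comp_inl,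
      not_exists, not_and, not_not, map_mul] at hy hz hgh
    rcases hprime.mem_or_mem ((hmemJ (map (eval (Sum.elim c b)) g * map (eval (Sum.elim c b)) h)).2
      fun y hy => by simpa using hgh y hy) with hm | hm
    · exact hyg ((hmemJ _).1 hm y hy)
    · exact hzh ((hmemJ _).1 hm z hz)

lemma isHomogeneous_homPolyOf {R : Type*} [CommRing R] {n d : ℕ} (c : MonoEq n d → R) :
    (homPolyOf c).IsHomogeneous d := by
  refine IsHomogeneous.sum _ _ _ fun e _ => isHomogeneous_monomial _ ?_
  simpa [Finsupp.degree_eq_sum] using e.2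

lemma map_homPolyOf {R S : Type*} [CommRing R] [CommRing S] {n d : ℕ} (φ : R →+* S)
    (c : MonoEq n d → R) : map φ (homPolyOf c) = homPolyOf (φ ∘ c) := by
  simp [homPolyOf]

end Definability

/-- Irreducibility of Zariski closed subsets of projective space is definable in
families: over an algebraically closed field `K`, for homogeneous polynomials
`F₁(c), …, F_r(c)` of degrees `d₁, …, d_r` with coefficient tuple `c`, the set
of `c` for which the common projective zero locus `V_c ⊆ ℙ^n(K)` is irreducible
is a constructible subset of the coefficient space. -/
theorem projective_irreducibility_definable
    {K : Type*} [Field K] [IsAlgClosed K] (n r : ℕ) (hn : 1 ≤ n) (hr : 1 ≤ r)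
    (dg : Fin r → ℕ) (hdg : ∀ j, 1 ≤ dg j) :
    IsConstructibleIn (zariskiTopology K ((j : Fin r) × MonoEq (n + 1) (dg j)))
      {c : ((j : Fin r) × MonoEq (n + 1) (dg j)) → K |
        @IsIrreducible _ (projZariskiTopology K n)
          {p : Projectivization K (Fin (n + 1) → K) |
            ∀ j : Fin r,
              MvPolynomial.eval p.rep (homPolyOf fun e => c ⟨j, e⟩) = 0}} := by
  have hd (j) : dg j ≠ 0 := Nat.one_le_iff_ne_zero.1 (hdg j)
  let F (j : Fin r) : MvPolynomial (Fin (n + 1))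
      (MvPolynomial ((j : Fin r) × MonoEq (n + 1) (dg j)) K) := homPolyOf fun e => X ⟨j, e⟩
  have hF (c) (j) : map (eval c) (F j) = homPolyOf fun e => c ⟨j, e⟩ := by
    simp [F, map_homPolyOf, Function.comp_def]
  have h := (isPointConstructible_isPrime_vanishingIdeal (F := F) hd
    fun j => isHomogeneous_homPolyOf _).isConstructibleIn
  simp only [hF] at h
  convert h using 3 with c
  exact isIrreducible_iff_isPrime_vanishingIdeal fun j => isHomogeneous_homPolyOf _
end

section
/- Let k ⊆ K be algebraically closed fields and let n ≥ 2. Let V ⊆ ℙ^n(K) be a Zariski closed set defined by homogeneous polynomials with coefficients in k, and suppose the Krull dimension of V is strictly less than n − 1 (V has codimension greater than 1). Let t₁, …, tₙ ∈ K be algebraically independent over k and set x = [1 : t₁ : ⋯ : tₙ] ∈ ℙ^n(K). Let H ⊆ ℙ^n(K) be the zero set of a nonzero linear form with x ∉ H, and let π_x : ℙ^n(K) ∖ {x} → H be the projection sending a point y ≠ x to the unique point of H on the projective line through x and y. Then: x ∉ V; π_x(V) is a Zariski closed subset of H; the Krull dimension of π_x(V) equals the Krull dimension of V; and π_x(V)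 has the same number of irreducible components as V — in particular, π_x(V) is irreducible if and only if V is irreducible. (This is Lemma A.1 of the paper's appendix.) -/
/-- The Krull dimension of a subset `S` of a topological space, i.e. the Krull
dimension of `S` with the subspace topology: the supremum of the lengths of
chains of irreducible closed subsets. -/
noncomputable def krullDimOf {α : Type*} (t : TopologicalSpace α) (S : Set α) :
    WithBot ℕ∞ :=
  @topologicalKrullDim (↥S) (TopologicalSpace.induced Subtype.val t)

/-- The irreducible components of a (closed) subset `C` of a topological space:
the maximal irreducible closed subsets contained in `C`. -/
def irredComps {α : Type*} (t : TopologicalSpace α) (C : Set α) : Set (Set α) :=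
  {T | Maximal (fun T => T ⊆ C ∧ @IsClosed _ t T ∧ @IsIrreducible _ t T) T}

namespace GenericProjection

open MvPolynomial Topology TopologicalSpace
open scoped LinearAlgebra.Projectivization

section Topology

variable {X Y : Type*} [TopologicalSpace X] [TopologicalSpace Y]

theorem isIrreducible_image_iff_of_isInducing {f : X → Y} (hf : IsInducing f) {s : Set X} :
    IsIrreducible (f '' s) ↔ IsIrreducible s := by
  refine ⟨fun h => ⟨Set.image_nonempty.1 h.1, ?_⟩, fun h => h.image f hf.continuous.continuousOn⟩
  intro u v hu hv hsu hsv
  obtain ⟨u', hu', rfl⟩ := hf.isOpen_iff.1 hu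
  obtain ⟨v', hv', rfl⟩ := hf.isOpen_iff.1 hv
  obtain ⟨a, has, hau⟩ := hsu
  obtain ⟨b, hbs, hbv⟩ := hsv
  obtain ⟨_, ⟨c, hcs, rfl⟩, hc⟩ := h.2 u' v' hu' hv' ⟨_, ⟨a, has, rfl⟩, hau⟩ ⟨_, ⟨b, hbs, rfl⟩, hbv⟩
  exact ⟨c, hcs, hc⟩

/-- In a Noetherian space, a closed map from a closed set onto an irreducible closed set `W`
already maps some irreducible closed subset onto `W`. -/
theorem exists_isIrreducible_image_eq [NoetherianSpace X] {f : X → Y} (hf : IsClosedMap f)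
    {C : Set X} (hC : IsClosed C) {W : Set Y} (hW : IsIrreducible W) (hCW : f '' C = W) :
    ∃ Z ⊆ C, IsClosed Z ∧ IsIrreducible Z ∧ f '' Z = W := by
  obtain ⟨S, hSf, hSc, hSi, rfl⟩ := NoetherianSpace.exists_finite_set_isClosed_irreducible hC
  have hfin : ((f '' ·) '' S).Finite := hSf.image _
  obtain ⟨z, hz, hWz⟩ := isIrreducible_iff_sUnion_isClosed.1 hW hfin.toFinset
    (by simpa using fun a ha => hf a (hSc a ha))
    (by rw [← hCW, Set.image_sUnion]; simp)
  obtain ⟨Z, hZ, rfl⟩ := hfin.mem_toFinset.1 hz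
  refine ⟨Z, Set.subset_sUnion_of_mem hZ, hSc Z hZ, hSi Z hZ, hWz.antisymm' ?_⟩
  rw [← hCW]
  exact Set.image_mono (Set.subset_sUnion_of_mem hZ)

/-- A closed continuous surjection from a Noetherian space for which distinct comparable
irreducible closed sets have distinct images preserves the Krull dimension. -/
theorem topologicalKrullDim_eq_of_isClosedMap [NoetherianSpace X] {f : X → Y}
    (hc : Continuous f) (hf : IsClosedMap f) (hs : Function.Surjective f)
    (hinc : ∀ Z₁ Z₂ : Set X, IsClosed Z₁ → IsClosed Z₂ → IsIrreducible Z₁ → IsIrreducible Z₂ →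
      Z₁ ⊆ Z₂ → f '' Z₁ = f '' Z₂ → Z₁ = Z₂) :
    topologicalKrullDim Y = topologicalKrullDim X := by
  let F : IrreducibleCloseds X → IrreducibleCloseds Y := fun Z =>
    ⟨f '' Z, Z.isIrreducible.image f hc.continuousOn, hf _ Z.isClosed⟩
  have hF : StrictMono F := by
    intro Z₁ Z₂ h
    refine lt_of_le_of_ne (Set.image_mono h.le) fun he => h.ne (IrreducibleCloseds.ext ?_)
    exact hinc _ _ Z₁.isClosed Z₂.isClosed Z₁.isIrreducible Z₂.isIrreducible h.le
      (congrArg (fun Z : IrreducibleCloseds Y => (Z : Set Y)) he)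
  refine le_antisymm ?_ (Order.krullDim_le_of_strictMono F hF)
  have key : ∀ m : ℕ, ∀ p : LTSeries (IrreducibleCloseds Y), p.length = m →
      ∃ q : LTSeries (IrreducibleCloseds X), q.length = m ∧ F q.head = p.head := by
    intro m
    induction m with
    | zero =>
      intro p hp
      obtain ⟨Z, -, hZc, hZi, hZ⟩ := exists_isIrreducible_image_eq hf
        (p.head.isClosed.preimage hc) p.head.isIrreducible (Set.image_preimage_eq _ hs)
      exact ⟨RelSeries.singleton _ ⟨Z, hZi, hZc⟩, rfl, IrreducibleCloseds.ext hZ⟩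
    | succ m ih =>
      intro p hp
      obtain ⟨q, hq, hqp⟩ := ih (p.tail (by omega)) (by simp [hp])
      have hlt : p.head < F q.head := by
        rw [hqp, RelSeries.head_tail]
        exact p.strictMono (Fin.mk_lt_mk.2 (by simp [hp]))
      obtain ⟨Z, hZq, hZc, hZi, hZ⟩ := exists_isIrreducible_image_eq (C := q.head ∩ f ⁻¹' p.head)
        hf (q.head.isClosed.inter (p.head.isClosed.preimage hc)) p.head.isIrreducible
        (by rw [Set.image_inter_preimage]; exact Set.inter_eq_right.2 hlt.le)
      have hFZ : F ⟨Z, hZi, hZc⟩ = p.head := IrreducibleCloseds.ext hZ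
      have hZlt : (⟨Z, hZi, hZc⟩ : IrreducibleCloseds X) < q.head := by
        refine lt_of_le_of_ne (fun z hz => (hZq hz).1) fun he => ?_
        rw [← he, hFZ] at hlt
        exact lt_irrefl _ hlt
      refine ⟨q.cons ⟨Z, hZi, hZc⟩ hZlt, ?_, ?_⟩
      · simp [hq]
      · simpa using hFZ
  refine iSup_le fun p => ?_
  obtain ⟨q, hq, -⟩ := key p.length p rfl
  rw [← hq]
  exact Order.LTSeries.length_le_krullDim q

end Topology

attribute [local instance] projZariskiTopology

section LineIdeal

variable {K σ : Type*} [Field K]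

/-- Restriction of a polynomial to the line `T ↦ T • w` through the origin. -/
noncomputable def lineHom (w : σ → K) : MvPolynomial σ K →ₐ[K] Polynomial K :=
  aeval fun i => Polynomial.C (w i) * Polynomial.X

theorem coeff_lineHom (w : σ → K) (f : MvPolynomial σ K) (d : ℕ) :
    (lineHom w f).coeff d = eval w (homogeneousComponent d f) := by
  classical
  induction f using MvPolynomial.induction_on' with
  | add p q hp hq => simp [hp, hq]
  | monomial s a =>
    have h : lineHom w (monomial s a) =
        Polynomial.C (a * s.prod fun i e => w i ^ e) * Polynomial.X ^ s.degree := by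
      simp only [lineHom, aeval_monomial, Finsupp.prod, mul_pow, Finset.prod_mul_distrib,
        Finset.prod_pow_eq_pow_sum, Polynomial.algebraMap_eq, map_mul, map_prod, map_pow,
        Finsupp.degree_apply]
      ring
    rw [h, Polynomial.coeff_C_mul_X_pow, homogeneousComponent_apply]
    by_cases hd : d = s.degree
    · subst hd
      by_cases ha : a = 0 <;>
        simp [eval_monomial, ha, coeff_monomial, support_monomial, Finset.filter_singleton]
    · rw [if_neg hd]
      by_cases ha : a = 0 <;> simp [ha, support_monomial, Finset.filter_singleton, Ne.symm hd]

theorem eval_lineHom (w : σ → K) (f : MvPolynomial σ K) (c : K) :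
    (lineHom w f).eval c = eval (c • w) f := by
  have : (Polynomial.aeval c).comp (lineHom w) = aeval (c • w) := by
    ext i
    simp only [AlgHom.comp_apply, lineHom, aeval_X, map_mul, Polynomial.aeval_C, Polynomial.aeval_X,
      Algebra.algebraMap_self, RingHom.id_apply, Pi.smul_apply, smul_eq_mul, mul_comm]
  simpa [aeval_eq_eval, Polynomial.coe_aeval_eq_eval] using DFunLike.congr_fun this f

theorem eval_smul_of_isHomogeneous {f : MvPolynomial σ K} {d : ℕ} (hf : f.IsHomogeneous d)
    (w : σ → K) (c : K) : eval (c • w) f = c ^ d * eval w f := by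
  classical
  have h : lineHom w f = Polynomial.C (eval w f) * Polynomial.X ^ d := by
    ext e
    rw [coeff_lineHom, homogeneousComponent_of_mem hf, Polynomial.coeff_C_mul_X_pow]
    split_ifs <;> simp
  rw [← eval_lineHom, h, Polynomial.eval_mul, Polynomial.eval_C, Polynomial.eval_pow,
    Polynomial.eval_X, mul_comm]

/-- The ideal of polynomials vanishing on the line spanned by `w`. -/
noncomputable def lineIdeal (w : σ → K) : Ideal (MvPolynomial σ K) :=
  RingHom.ker (lineHom w)

instance (w : σ → K) : (lineIdeal w).IsPrime := RingHom.ker_isPrime _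

theorem mem_lineIdeal {w : σ → K} {f : MvPolynomial σ K} :
    f ∈ lineIdeal w ↔ ∀ d, eval w (homogeneousComponent d f) = 0 := by
  rw [lineIdeal, RingHom.mem_ker, Polynomial.ext_iff]
  simp [coeff_lineHom]

theorem mem_lineIdeal_iff_eval [Infinite K] {w : σ → K} {f : MvPolynomial σ K} :
    f ∈ lineIdeal w ↔ ∀ c : K, eval (c • w) f = 0 := by
  rw [lineIdeal, RingHom.mem_ker]
  refine ⟨fun h c => by rw [← eval_lineHom, h, Polynomial.eval_zero], fun h => ?_⟩
  exact Polynomial.funext fun c => by rw [eval_lineHom, h, Polynomial.eval_zero]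

theorem mem_lineIdeal_of_isHomogeneous {w : σ → K} {f : MvPolynomial σ K} {d : ℕ}
    (hf : f.IsHomogeneous d) : f ∈ lineIdeal w ↔ eval w f = 0 := by
  rw [mem_lineIdeal]
  refine ⟨fun h => by simpa [homogeneousComponent_of_mem hf] using h d, fun h e => ?_⟩
  rw [homogeneousComponent_of_mem hf]
  split_ifs <;> simp [h]

theorem eval_eq_zero_of_mem_lineIdeal {w : σ → K} {f : MvPolynomial σ K} (hf : f ∈ lineIdeal w) :
    eval w f = 0 := by
  rw [← sum_homogeneousComponent f, map_sum]
  exact Finset.sum_eq_zero fun d _ => mem_lineIdeal.1 hf d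

theorem homogeneousComponent_mem_lineIdeal {w : σ → K} {f : MvPolynomial σ K}
    (hf : f ∈ lineIdeal w) (d : ℕ) : homogeneousComponent d f ∈ lineIdeal w :=
  (mem_lineIdeal_of_isHomogeneous (homogeneousComponent_isHomogeneous d f)).2 (mem_lineIdeal.1 hf d)

theorem lineIdeal_smul (w : σ → K) {c : K} (hc : c ≠ 0) : lineIdeal (c • w) = lineIdeal w := by
  ext f
  simp only [mem_lineIdeal,
    fun d => eval_smul_of_isHomogeneous (homogeneousComponent_isHomogeneous d f) w c]
  simp [hc]

end LineIdeal

section Zariski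

variable {K : Type*} [Field K] {n : ℕ}

theorem lineIdeal_rep_mk (w : Fin (n + 1) → K) (hw : w ≠ 0) :
    lineIdeal (Projectivization.mk K w hw).rep = lineIdeal w := by
  obtain ⟨a, ha⟩ := Projectivization.exists_smul_eq_mk_rep K w hw
  rw [← ha]
  exact lineIdeal_smul w a.ne_zero

/-- The homogeneous prime ideal of a point of projective space. -/
noncomputable def pointIdeal (p : ℙ K (Fin (n + 1) → K)) :
    PrimeSpectrum (MvPolynomial (Fin (n + 1)) K) :=
  ⟨lineIdeal p.rep, inferInstance⟩

theorem isInducing_pointIdeal :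
    IsInducing (pointIdeal : ℙ K (Fin (n + 1) → K) → _) := by
  have hb : ∀ f : MvPolynomial (Fin (n + 1)) K,
      pointIdeal ⁻¹' (PrimeSpectrum.basicOpen f : Set _) =
        ⋃ d, {p : ℙ K (Fin (n + 1) → K) | eval p.rep (homogeneousComponent d f) ≠ 0} := by
    intro f
    ext p
    simp only [Set.mem_preimage, SetLike.mem_coe, PrimeSpectrum.mem_basicOpen, pointIdeal,
      mem_lineIdeal, Set.mem_iUnion, Set.mem_ofPred_eq, not_forall, ne_eq]
  constructor
  apply le_antisymm
  · rw [← continuous_iff_le_induced, PrimeSpectrum.isTopologicalBasis_basic_opens.continuous_iff]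
    rintro _ ⟨f, rfl⟩
    rw [hb]
    exact isOpen_iUnion fun d => isOpen_generateFrom_of_mem
      ⟨d, _, homogeneousComponent_isHomogeneous d f, rfl⟩
  · refine le_generateFrom ?_
    rintro _ ⟨d, f, hf, rfl⟩
    refine isOpen_induced_iff.2 ⟨_, (PrimeSpectrum.basicOpen f).isOpen, ?_⟩
    ext p
    simp only [Set.mem_preimage, SetLike.mem_coe, PrimeSpectrum.mem_basicOpen, pointIdeal,
      mem_lineIdeal_of_isHomogeneous hf, Set.mem_ofPred_eq, ne_eq]

theorem isClosed_setOf_eval_eq_zero {f : MvPolynomial (Fin (n + 1)) K} {d : ℕ}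
    (hf : f.IsHomogeneous d) : IsClosed {p : ℙ K (Fin (n + 1) → K) | eval p.rep f = 0} := by
  rw [← isOpen_compl_iff]
  exact isOpen_generateFrom_of_mem ⟨d, f, hf, rfl⟩

instance : NoetherianSpace (ℙ K (Fin (n + 1) → K)) :=
  isInducing_pointIdeal.noetherianSpace

/-- The homogeneous ideal of a subset of projective space. -/
noncomputable def homIdeal (Z : Set (ℙ K (Fin (n + 1) → K))) :
    Ideal (MvPolynomial (Fin (n + 1)) K) :=
  PrimeSpectrum.vanishingIdeal (pointIdeal '' Z)

theorem mem_homIdeal {Z : Set (ℙ K (Fin (n + 1) → K))} {f : MvPolynomial (Fin (n + 1)) K} :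
    f ∈ homIdeal Z ↔ ∀ p ∈ Z, f ∈ lineIdeal p.rep := by
  simp [homIdeal, PrimeSpectrum.mem_vanishingIdeal, pointIdeal]

theorem homIdeal_anti {Z₁ Z₂ : Set (ℙ K (Fin (n + 1) → K))} (h : Z₁ ⊆ Z₂) :
    homIdeal Z₂ ≤ homIdeal Z₁ := fun _ hf =>
  mem_homIdeal.2 fun p hp => mem_homIdeal.1 hf p (h hp)

theorem isIrreducible_iff_isPrime_homIdeal {Z : Set (ℙ K (Fin (n + 1) → K))} :
    IsIrreducible Z ↔ (homIdeal Z).IsPrime := by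
  rw [← isIrreducible_image_iff_of_isInducing isInducing_pointIdeal,
    PrimeSpectrum.isIrreducible_iff_vanishingIdeal_isPrime, homIdeal]

theorem mem_closure_iff_homIdeal_le {Z : Set (ℙ K (Fin (n + 1) → K))}
    {p : ℙ K (Fin (n + 1) → K)} : p ∈ closure Z ↔ homIdeal Z ≤ lineIdeal p.rep := by
  rw [isInducing_pointIdeal.closure_eq_preimage_closure_image,
    ← PrimeSpectrum.zeroLocus_vanishingIdeal_eq_closure]
  rfl

theorem mem_closure_iff {Z : Set (ℙ K (Fin (n + 1) → K))} {p : ℙ K (Fin (n + 1) → K)} :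
    p ∈ closure Z ↔ ∀ (d : ℕ) (f : MvPolynomial (Fin (n + 1)) K), f.IsHomogeneous d →
      (∀ q ∈ Z, eval q.rep f = 0) → eval p.rep f = 0 := by
  rw [mem_closure_iff_homIdeal_le]
  refine ⟨fun h d f hf hZ => ?_, fun h f hf => mem_lineIdeal.2 fun d => ?_⟩
  · exact (mem_lineIdeal_of_isHomogeneous hf).1 (h (mem_homIdeal.2 fun q hq =>
      (mem_lineIdeal_of_isHomogeneous hf).2 (hZ q hq)))
  · exact h d _ (homogeneousComponent_isHomogeneous d f) fun q hq =>
      mem_lineIdeal.1 (mem_homIdeal.1 hf q hq) d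

end Zariski

section Translate

variable {K σ : Type*} [Field K]

/-- The polynomial `f (X + T v)` in the variable `T`. -/
noncomputable def translate (v : σ → K) :
    MvPolynomial σ K →ₐ[K] Polynomial (MvPolynomial σ K) :=
  aeval fun i => Polynomial.C (X i) + Polynomial.X * Polynomial.C (C (v i))

theorem translate_monomial (v : σ → K) (s : σ →₀ ℕ) :
    (translate v (monomial s 1)).natDegree ≤ s.degree ∧
      (translate v (monomial s 1)).coeff s.degree = C (eval v (monomial s 1)) := by
  induction s using Finsupp.induction_linear with
  | zero => simp
  | add s t hs ht =>
    have h : monomial (s + t) (1 : K) = monomial s 1 * monomial t 1 := by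
      rw [monomial_mul, one_mul]
    rw [h, map_mul, map_mul, map_mul, map_add]
    refine ⟨Polynomial.natDegree_mul_le.trans (add_le_add hs.1 ht.1), ?_⟩
    rw [Polynomial.coeff_mul_add_eq_of_natDegree_le hs.1 ht.1, hs.2, ht.2]
  | single i e =>
    have h : translate v (monomial (Finsupp.single i e) 1) =
        (Polynomial.C (X i) + Polynomial.X * Polynomial.C (C (v i))) ^ e := by
      simp [translate, aeval_monomial]
    have hd : (Polynomial.C (X i) + Polynomial.X * Polynomial.C (C (v i)) :
        Polynomial (MvPolynomial σ K)).natDegree ≤ 1 := by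
      compute_degree
    have hc := Polynomial.coeff_pow_of_natDegree_le (m := e) hd
    have hn := Polynomial.natDegree_pow_le_of_le e hd
    rw [mul_one] at hc hn
    rw [h, Finsupp.degree_single]
    refine ⟨hn, ?_⟩
    rw [hc]
    simp [eval_monomial, Polynomial.coeff_C]

theorem translate_of_isHomogeneous (v : σ → K) {f : MvPolynomial σ K} {d : ℕ}
    (hf : f.IsHomogeneous d) :
    (translate v f).natDegree ≤ d ∧ (translate v f).coeff d = C (eval v f) := by
  have hs : ∀ s ∈ f.support, s.degree = d := fun s h => by
    rw [Finsupp.degree_eq_weight_one]; exact hf (mem_support_iff.1 h)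
  have hm : ∀ s, translate v (monomial s (coeff s f)) =
      Polynomial.C (C (coeff s f)) * translate v (monomial s 1) := by
    intro s
    rw [← mul_one (coeff s f), ← smul_eq_mul, ← smul_monomial, map_smul, smul_eq_mul, mul_one]
    ext1 e
    rw [Polynomial.coeff_smul, Polynomial.coeff_C_mul, smul_eq_C_mul]
  have he : ∀ s, eval v (monomial s (coeff s f)) = coeff s f * eval v (monomial s 1) := by
    simp [eval_monomial]
  rw [f.as_sum, map_sum, map_sum, map_sum]
  constructor
  · refine Polynomial.natDegree_sum_le_of_forall_le _ _ fun s h => ?_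
    rw [hm]
    exact (Polynomial.natDegree_C_mul_le _ _).trans
      ((translate_monomial v s).1.trans (hs s h).le)
  · rw [Polynomial.finsetSum_coeff]
    refine Finset.sum_congr rfl fun s h => ?_
    rw [hm, he, map_mul, Polynomial.coeff_C_mul, ← hs s h, (translate_monomial v s).2]

end Translate

section Pullback

variable {K σ : Type*} [Field K] [Fintype σ]

/-- Precomposition of polynomials with the linear map given by a matrix. -/
noncomputable def pull (M : Matrix σ σ K) : MvPolynomial σ K →ₐ[K] MvPolynomial σ K :=
  aeval M.toMvPolynomial

theorem eval_pull (M : Matrix σ σ K) (w : σ → K) (g : MvPolynomial σ K) :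
    eval w (pull M g) = eval (M.mulVec w) g := by
  have : (aeval w).comp (pull M) = aeval (M.mulVec w) := by
    ext i
    simp [pull, aeval_eq_eval, Matrix.toMvPolynomial_eval_eq_apply]
  simpa [aeval_eq_eval] using DFunLike.congr_fun this g

theorem isHomogeneous_pull (M : Matrix σ σ K) {g : MvPolynomial σ K} {d : ℕ}
    (hg : g.IsHomogeneous d) : (pull M g).IsHomogeneous d := by
  simpa [pull] using hg.aeval _ M.toMvPolynomial_isHomogeneous

theorem pull_mem_lineIdeal [Infinite K] (M : Matrix σ σ K) {w : σ → K} {g : MvPolynomial σ K} :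
    pull M g ∈ lineIdeal w ↔ g ∈ lineIdeal (M.mulVec w) := by
  simp only [mem_lineIdeal_iff_eval, eval_pull, Matrix.mulVec_smul]

variable [DecidableEq σ]

/-- The matrix of the linear projection `w ↦ w - (a ⬝ w) • v`. -/
def projMatrix (v a : σ → K) : Matrix σ σ K := 1 - Matrix.vecMulVec v a

theorem projMatrix_mulVec (v a w : σ → K) :
    (projMatrix v a).mulVec w = w - (a ⬝ᵥ w) • v := by
  ext i
  simp [projMatrix, Matrix.sub_mulVec, Matrix.vecMulVec_mulVec, mul_comm]

theorem projMatrix_mulVec_self {v a : σ → K} (h : a ⬝ᵥ v = 1) :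
    (projMatrix v a).mulVec v = 0 := by
  simp [projMatrix_mulVec, h]

theorem eval₂_translate [Infinite K] (v a : σ → K) (f : MvPolynomial σ K) :
    (translate v f).eval₂ (pull (projMatrix v a)).toRingHom (∑ j, C (a j) * X j) = f := by
  have : (Polynomial.eval₂RingHom (pull (projMatrix v a)).toRingHom (∑ j, C (a j) * X j)).comp
      (translate v).toRingHom = RingHom.id _ := by
    refine MvPolynomial.ringHom_ext (fun c => ?_) fun i => ?_
    · simp [translate, IsScalarTower.algebraMap_apply K (MvPolynomial σ K)
        (Polynomial (MvPolynomial σ K))]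
    · refine MvPolynomial.funext fun w => ?_
      simp [translate, eval_pull, projMatrix_mulVec, dotProduct]
      ring
  exact RingHom.congr_fun this f

end Pullback

section Integral

variable {R S : Type*} [CommRing R] [CommRing S] {h : R →+* S}

theorem exists_isMaximal_comap_eq_of_isIntegral (hint : h.IsIntegral) (P : Ideal R) [P.IsMaximal]
    (hker : RingHom.ker h ≤ P) : ∃ Q : Ideal S, Q.IsMaximal ∧ Q.comap h = P := by
  algebraize [h]
  exact Ideal.exists_ideal_over_maximal_of_isIntegral P hker

theorem exists_map_mem_of_isIntegral [IsDomain S] (hint : h.IsIntegral) {J : Ideal S} {x : S}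
    (hx : x ∈ J) (hx0 : x ≠ 0) : ∃ r, h r ∈ J ∧ h r ≠ 0 := by
  algebraize [h]
  have hlt := Ideal.comap_lt_comap_of_integral_mem_sdiff (R := R) (I := ⊥) (J := J) bot_le
    (x := x) ⟨hx, hx0⟩ (hint x)
  obtain ⟨f, hf₁, hf₂⟩ := SetLike.exists_of_lt hlt
  exact ⟨f, hf₁, hf₂⟩

end Integral

section Projection

variable {K : Type*} [Field K] {n : ℕ} {v a : Fin (n + 1) → K}
  {π : ℙ K (Fin (n + 1) → K) → ℙ K (Fin (n + 1) → K)}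

/-- `π` is the projection from the point `[v]` to the hyperplane `a ⬝ y = 0`. -/
structure IsProjection (v a : Fin (n + 1) → K)
    (π : ℙ K (Fin (n + 1) → K) → ℙ K (Fin (n + 1) → K)) : Prop where
  ne_zero : v ≠ 0
  dotProduct_eq_one : a ⬝ᵥ v = 1
  apply_eq : ∀ p, p ≠ Projectivization.mk K v ne_zero →
    ∃ h : (projMatrix v a).mulVec p.rep ≠ 0, π p = Projectivization.mk K _ h

theorem projMatrix_mulVec_rep_ne_zero (hv : v ≠ 0) {p : ℙ K (Fin (n + 1) → K)}
    (hp : p ≠ Projectivization.mk K v hv) : (projMatrix v a).mulVec p.rep ≠ 0 := by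
  intro h
  rw [projMatrix_mulVec, sub_eq_zero] at h
  refine hp ?_
  rw [← p.mk_rep, Projectivization.mk_eq_mk_iff']
  exact ⟨_, h.symm⟩

theorem exists_isProjection (h : a ⬝ᵥ v = 1) : ∃ π, IsProjection v a π := by
  classical
  have hv : v ≠ 0 := by rintro rfl; simp at h
  refine ⟨fun p => if hp : (projMatrix v a).mulVec p.rep ≠ 0 then
    Projectivization.mk K _ hp else p, hv, h, fun p hp => ?_⟩
  have := projMatrix_mulVec_rep_ne_zero (a := a) hv hp
  exact ⟨this, dif_pos this⟩

namespace IsProjection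

/-- The centre of a projection. -/
def center (_ : IsProjection v a π) : ℙ K (Fin (n + 1) → K) :=
  Projectivization.mk K v (IsProjection.ne_zero ‹_›)

variable (hπ : IsProjection v a π)
include hπ

theorem lineIdeal_apply {p : ℙ K (Fin (n + 1) → K)} (hp : p ≠ hπ.center) :
    lineIdeal (π p).rep = lineIdeal ((projMatrix v a).mulVec p.rep) := by
  obtain ⟨h, hp⟩ := hπ.apply_eq p hp
  rw [hp, lineIdeal_rep_mk]

theorem eval_apply_eq_zero_iff {p : ℙ K (Fin (n + 1) → K)} (hp : p ≠ hπ.center)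
    {f : MvPolynomial (Fin (n + 1)) K} {d : ℕ} (hf : f.IsHomogeneous d) :
    eval (π p).rep f = 0 ↔ eval p.rep (pull (projMatrix v a) f) = 0 := by
  rw [← mem_lineIdeal_of_isHomogeneous hf, hπ.lineIdeal_apply hp,
    mem_lineIdeal_of_isHomogeneous hf, eval_pull]

theorem continuousOn {Z : Set (ℙ K (Fin (n + 1) → K))} (hZ : hπ.center ∉ Z) :
    ContinuousOn π Z := by
  rw [continuousOn_iff_continuous_domRestrict, projZariskiTopology, continuous_generateFrom_iff]
  rintro _ ⟨d, f, hf, rfl⟩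
  have hopen := (isClosed_setOf_eval_eq_zero (isHomogeneous_pull (projMatrix v a) hf)).isOpen_compl
  refine (congrArg IsOpen (Set.ext fun p => ?_)).mp (hopen.preimage continuous_subtype_val)
  have hne : p.1 ≠ hπ.center := fun h => hZ (h ▸ p.2)
  exact (hπ.eval_apply_eq_zero_iff hne hf).not.symm

variable [IsAlgClosed K]

theorem mem_homIdeal_image_iff {Z : Set (ℙ K (Fin (n + 1) → K))} (hZ : hπ.center ∉ Z)
    {g : MvPolynomial (Fin (n + 1)) K} :
    g ∈ homIdeal (π '' Z) ↔ pull (projMatrix v a) g ∈ homIdeal Z := by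
  have := IsAlgClosed.instInfinite (K := K)
  simp only [mem_homIdeal, Set.forall_mem_image]
  refine forall₂_congr fun p hp => ?_
  rw [hπ.lineIdeal_apply fun h => hZ (h ▸ hp), pull_mem_lineIdeal]

theorem isIntegral_mk_comp_pull {Z : Set (ℙ K (Fin (n + 1) → K))} (hZ : hπ.center ∉ closure Z) :
    ((Ideal.Quotient.mk (homIdeal Z)).comp (pull (projMatrix v a)).toRingHom).IsIntegral := by
  have := IsAlgClosed.instInfinite (K := K)
  rw [mem_closure_iff] at hZ
  push Not at hZ
  obtain ⟨d, f, hf, hfZ, hfv⟩ := hZ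
  have hfv : eval v f ≠ 0 := by
    rwa [center, Ne, ← mem_lineIdeal_of_isHomogeneous hf, lineIdeal_rep_mk,
      mem_lineIdeal_of_isHomogeneous hf] at hfv
  set φ := (pull (projMatrix v a)).toRingHom with hφ
  set q := Ideal.Quotient.mk (homIdeal Z) with hq
  set L : MvPolynomial (Fin (n + 1)) K := ∑ j, C (a j) * X j with hL
  have hfI : q f = 0 := Ideal.Quotient.eq_zero_iff_mem.2 (mem_homIdeal.2 fun p hp =>
    (mem_lineIdeal_of_isHomogeneous hf).2 (hfZ p hp))
  have hLint : (q.comp φ).IsIntegralElem (q L) := by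
    refine ⟨Polynomial.C (C (eval v f)⁻¹) * translate v f, ?_, ?_⟩
    · refine Polynomial.monic_of_natDegree_le_of_coeff_eq_one d
        ((Polynomial.natDegree_C_mul_le _ _).trans (translate_of_isHomogeneous v hf).1) ?_
      rw [Polynomial.coeff_C_mul, (translate_of_isHomogeneous v hf).2, ← map_mul,
        inv_mul_cancel₀ hfv, map_one]
    · rw [← Polynomial.hom_eval₂, Polynomial.eval₂_mul, eval₂_translate, map_mul, hfI, mul_zero]
  intro y
  obtain ⟨g, rfl⟩ := Ideal.Quotient.mk_surjective y
  induction g using MvPolynomial.induction_on with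
  | C c =>
    have : q (C c) = q.comp φ (C c) := by simp [hφ, pull, MvPolynomial.algebraMap_eq]
    exact this ▸ RingHom.isIntegralElem_map _
  | add p r hp hr => rw [map_add]; exact hp.add _ hr
  | mul_X p i hp =>
    rw [map_mul]
    refine hp.mul _ ?_
    have h : X i = φ (X i) + C (v i) * L := by
      refine MvPolynomial.funext fun w => ?_
      simp [hφ, hL, eval_pull, projMatrix_mulVec, dotProduct]
      ring
    have hC : C (v i) = φ (C (v i)) := by simp [hφ, pull, MvPolynomial.algebraMap_eq]
    rw [h, map_add, map_mul, hC]
    exact (RingHom.isIntegralElem_map (q.comp φ)).add _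
      ((RingHom.isIntegralElem_map (q.comp φ)).mul _ hLint)

theorem isClosed_image {Z : Set (ℙ K (Fin (n + 1) → K))} (hZc : IsClosed Z)
    (hZ : hπ.center ∉ Z) : IsClosed (π '' Z) := by
  have hint := hπ.isIntegral_mk_comp_pull (hZc.closure_eq.symm ▸ hZ)
  have := IsAlgClosed.instInfinite (K := K)
  rw [← closure_subset_iff_isClosed]
  intro z hz
  rw [mem_closure_iff_homIdeal_le] at hz
  have hker : RingHom.ker ((Ideal.Quotient.mk (homIdeal Z)).comp
      (pull (projMatrix v a)).toRingHom) ≤ vanishingIdeal K {z.rep} := by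
    intro g hg
    have : g ∈ homIdeal (π '' Z) :=
      (hπ.mem_homIdeal_image_iff hZ).2 (Ideal.Quotient.eq_zero_iff_mem.1 hg)
    simpa [aeval_eq_eval] using eval_eq_zero_of_mem_lineIdeal (hz this)
  obtain ⟨Q, hQ, hQz⟩ := exists_isMaximal_comap_eq_of_isIntegral hint _ hker
  obtain ⟨w, hw⟩ := isMaximal_iff_eq_vanishingIdeal_singleton.1
    (Ideal.comap_isMaximal_of_surjective (Ideal.Quotient.mk (homIdeal Z))
      Ideal.Quotient.mk_surjective (K := Q))
  have hwQ : ∀ g, Ideal.Quotient.mk (homIdeal Z) g ∈ Q ↔ eval w g = 0 := fun g => by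
    rw [← Ideal.mem_comap, hw]; simp [aeval_eq_eval]
  have hMw : (projMatrix v a).mulVec w = z.rep := by
    ext i
    have h1 : X i - C (z.rep i) ∈ vanishingIdeal K {z.rep} := by simp
    rw [← hQz, Ideal.mem_comap] at h1
    have h2 := (hwQ (pull (projMatrix v a) (X i - C (z.rep i)))).1 h1
    rw [eval_pull] at h2
    simpa [sub_eq_zero] using h2
  have hw0 : w ≠ 0 := by
    rintro rfl
    exact z.rep_nonzero (by simpa using hMw.symm)
  have hwZ : Projectivization.mk K w hw0 ∈ Z := by
    rw [← hZc.closure_eq, mem_closure_iff_homIdeal_le, lineIdeal_rep_mk]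
    intro f hf
    refine mem_lineIdeal.2 fun d => (hwQ _).1 ?_
    rw [Ideal.Quotient.eq_zero_iff_mem.2]
    · exact Q.zero_mem
    · exact mem_homIdeal.2 fun p hp => homogeneousComponent_mem_lineIdeal (mem_homIdeal.1 hf p hp) d
  refine ⟨_, hwZ, ?_⟩
  obtain ⟨h0, h1⟩ := hπ.apply_eq _ fun h => hZ ((congrArg (· ∈ Z) h).mp hwZ)
  obtain ⟨c, hc⟩ := Projectivization.exists_smul_eq_mk_rep K w hw0
  rw [h1, ← z.mk_rep, Projectivization.mk_eq_mk_iff']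
  exact ⟨c, by rw [← hc, ← hMw, ← Matrix.mulVec_smul]; rfl⟩

theorem eq_of_image_eq {Z₁ Z₂ : Set (ℙ K (Fin (n + 1) → K))} (h₁ : IsClosed Z₁) (h₂ : IsClosed Z₂)
    (hi : IsIrreducible Z₂) (hZ : hπ.center ∉ Z₂) (hle : Z₁ ⊆ Z₂) (he : π '' Z₁ = π '' Z₂) :
    Z₁ = Z₂ := by
  have hint := hπ.isIntegral_mk_comp_pull (h₂.closure_eq.symm ▸ hZ)
  have := isIrreducible_iff_isPrime_homIdeal.1 hi
  refine hle.antisymm ?_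
  suffices homIdeal Z₁ ≤ homIdeal Z₂ by
    rw [← h₁.closure_eq]
    exact fun p hp => mem_closure_iff_homIdeal_le.2
      (this.trans (mem_closure_iff_homIdeal_le.1 (subset_closure hp)))
  intro g hg
  by_contra hg'
  obtain ⟨f, hf₁, hf₂⟩ := exists_map_mem_of_isIntegral hint
    (Ideal.mem_map_of_mem (Ideal.Quotient.mk (homIdeal Z₂)) hg)
    fun h => hg' (Ideal.Quotient.eq_zero_iff_mem.1 h)
  refine hf₂ (Ideal.Quotient.eq_zero_iff_mem.2 ((hπ.mem_homIdeal_image_iff hZ).1 ?_))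
  rw [← he, hπ.mem_homIdeal_image_iff fun h => hZ (hle h)]
  exact (Ideal.mem_quotient_iff_mem (homIdeal_anti hle)).1 hf₁

theorem krullDimOf_image {Z : Set (ℙ K (Fin (n + 1) → K))} (hZc : IsClosed Z)
    (hZ : hπ.center ∉ Z) :
    krullDimOf (projZariskiTopology K n) (π '' Z) = krullDimOf (projZariskiTopology K n) Z := by
  have him : ∀ T : Set Z, Subtype.val '' ((Set.imageFactorization π Z) '' T) =
      π '' (Subtype.val '' T) := fun T => by
    rw [Set.image_image, Set.image_image]; rfl
  have hemb := hZc.isClosedEmbedding_subtypeVal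
  have hsub : ∀ T : Set Z, hπ.center ∉ Subtype.val '' T := by
    rintro T ⟨p, -, hp⟩
    exact hZ (hp ▸ p.2)
  refine topologicalKrullDim_eq_of_isClosedMap (f := Set.imageFactorization π Z) ?_ ?_
    Set.imageFactorization_surjective ?_
  · exact (continuousOn_iff_continuous_domRestrict.1 (hπ.continuousOn hZ)).subtype_mk _
  · intro T hT
    refine (hπ.isClosed_image hZc hZ).isClosedEmbedding_subtypeVal.isClosed_iff_image_isClosed.2 ?_
    rw [him]
    exact hπ.isClosed_image (hemb.isClosedMap _ hT) (hsub T)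
  · intro Z₁ Z₂ h₁ h₂ _ i₂ hle he
    refine Subtype.val_injective.image_injective ?_
    refine hπ.eq_of_image_eq (hemb.isClosedMap _ h₁) (hemb.isClosedMap _ h₂)
      (i₂.image _ continuous_subtype_val.continuousOn) (hsub _) (Set.image_mono hle) ?_
    rw [← him, ← him, he]

end IsProjection

end Projection

section Topology

variable {X : Type*} [t : TopologicalSpace X]

theorem le_krullDimOf_of_strictMono {V : Set X} {m : ℕ} {L : Fin (m + 1) → Set X}
    (hc : ∀ j, IsClosed (L j)) (hi : ∀ j, IsIrreducible (L j)) (hV : ∀ j, L j ⊆ V)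
    (hL : StrictMono L) : ((m : ℕ∞) : WithBot ℕ∞) ≤ krullDimOf t V := by
  have him (j) : (Subtype.val '' (Subtype.val ⁻¹' L j : Set V)) = L j := by
    rw [Subtype.image_preimage_coe, Set.inter_eq_right.2 (hV j)]
  let F : Fin (m + 1) → IrreducibleCloseds V := fun j =>
    ⟨Subtype.val ⁻¹' L j, (isIrreducible_image_iff_of_isInducing IsInducing.subtypeVal).1
      ((him j).symm ▸ hi j), (hc j).preimage continuous_subtype_val⟩
  have hF : StrictMono F := fun i j hij => by
    refine lt_of_le_of_ne (Set.preimage_mono (hL hij).le : _) fun h => (hL hij).ne ?_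
    rw [← him i, ← him j]
    exact congrArg (fun Z : IrreducibleCloseds V => Subtype.val '' (Z : Set V)) h
  exact Order.LTSeries.length_le_krullDim (LTSeries.mk m F hF)

theorem subset_closure_inter_of_mem_irredComps [NoetherianSpace X] {V R T : Set X}
    (hVc : IsClosed V) (hV : V ⊆ closure (V ∩ R)) (hT : T ∈ irredComps t V) :
    T ⊆ closure (T ∩ R) := by
  obtain ⟨F, hF, hFc, hFi, rfl⟩ := NoetherianSpace.exists_finite_set_isClosed_irreducible hVc
  obtain ⟨⟨hTV, hTc, hTi⟩, hmax⟩ := hT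
  have hsub : T ⊆ ⋃₀ ((fun Z => closure (Z ∩ R)) '' F) := by
    refine (hTV.trans hV).trans (closure_minimal ?_ ?_)
    · rintro p ⟨⟨Z, hZ, hp⟩, hpR⟩
      exact ⟨_, ⟨Z, hZ, rfl⟩, subset_closure ⟨hp, hpR⟩⟩
    · rw [Set.sUnion_image]
      exact hF.isClosed_biUnion fun _ _ => isClosed_closure
  have := (isIrreducible_iff_sUnion_isClosed.1 hTi) (hF.image fun Z => closure (Z ∩ R)).toFinset (by
    rintro _ h
    obtain ⟨Z, -, rfl⟩ := (hF.image _).mem_toFinset.1 h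
    exact isClosed_closure) (by simpa using hsub)
  obtain ⟨_, h, hle⟩ := this
  obtain ⟨Z, hZ, rfl⟩ := (hF.image _).mem_toFinset.1 h
  have hTZ : T ⊆ Z := hle.trans (closure_minimal Set.inter_subset_left (hFc Z hZ))
  have hZT : Z ⊆ T := hmax ⟨Set.subset_sUnion_of_mem hZ, hFc Z hZ, hFi Z hZ⟩ hTZ
  exact hle.trans (closure_mono (Set.inter_subset_inter_left _ hZT))

end Topology

section LinearSubspace

variable {K : Type*} [Field K] {n : ℕ}

theorem isClosed_setOf_rep_eq_zero (s : Set (Fin (n + 1))) :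
    IsClosed {p : ℙ K (Fin (n + 1) → K) | ∀ j ∉ s, p.rep j = 0} := by
  simp only [Set.ofPred_forall]
  refine isClosed_iInter fun j => isClosed_iInter fun _ => ?_
  simpa using isClosed_setOf_eval_eq_zero (isHomogeneous_X K j)

theorem mk_single_mem_iff {s : Set (Fin (n + 1))} {i : Fin (n + 1)}
    (h : (Pi.single i 1 : Fin (n + 1) → K) ≠ 0) :
    Projectivization.mk K _ h ∈ {p : ℙ K (Fin (n + 1) → K) | ∀ j ∉ s, p.rep j = 0} ↔ i ∈ s := by
  obtain ⟨c, hc⟩ := Projectivization.exists_smul_eq_mk_rep K _ h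
  simp only [Set.mem_ofPred_eq, ← hc]
  refine ⟨fun H => by_contra fun hi => by simpa [Units.smul_def] using H i hi, fun hi j hj => ?_⟩
  have : j ≠ i := fun h => hj (h ▸ hi)
  simp [this]

variable [Infinite K]

theorem isIrreducible_setOf_rep_eq_zero {s : Set (Fin (n + 1))} (hs : s.Nonempty) :
    IsIrreducible {p : ℙ K (Fin (n + 1) → K) | ∀ j ∉ s, p.rep j = 0} := by
  classical
  rw [isIrreducible_iff_isPrime_homIdeal]
  let φ : MvPolynomial (Fin (n + 1)) K →ₐ[K] MvPolynomial (Fin (n + 1)) K :=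
    aeval fun j => if j ∈ s then X j else 0
  have hφ (w : Fin (n + 1) → K) (f) : eval w (φ f) = eval (fun j => if j ∈ s then w j else 0) f := by
    induction f using MvPolynomial.induction_on with
    | C c => simp [φ]
    | add p q hp hq => simp [hp, hq]
    | mul_X p i hp => rw [map_mul, map_mul, hp, map_mul, aeval_X, eval_X]; split_ifs <;> simp
  suffices homIdeal {p : ℙ K (Fin (n + 1) → K) | ∀ j ∉ s, p.rep j = 0} = RingHom.ker φ.toRingHom by
    rw [this]; exact RingHom.ker_isPrime _
  ext f
  rw [mem_homIdeal, RingHom.mem_ker]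
  constructor
  · refine fun h => MvPolynomial.funext fun w => ?_
    rw [AlgHom.toRingHom_eq_coe, RingHom.coe_coe, hφ, map_zero]
    set w' : Fin (n + 1) → K := fun j => if j ∈ s then w j else 0 with hw'
    by_cases h0 : w' = 0
    · obtain ⟨i, hi⟩ := hs
      have h1 : (Pi.single i 1 : Fin (n + 1) → K) ≠ 0 := by simp
      have := mem_lineIdeal_iff_eval.1 (h _ ((mk_single_mem_iff h1).2 hi)) 0
      rwa [zero_smul, ← h0] at this
    · obtain ⟨c, hc⟩ := Projectivization.exists_smul_eq_mk_rep K _ h0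
      have := h (Projectivization.mk K w' h0) fun j hj => by
        rw [← hc]; simp [hw', hj]
      rw [lineIdeal_rep_mk, mem_lineIdeal_iff_eval] at this
      simpa using this 1
  · intro h p hp
    rw [mem_lineIdeal_iff_eval]
    intro c
    have := hφ (c • p.rep) f
    rw [show φ f = 0 from h, map_zero] at this
    rw [this]
    congr 2
    ext j
    by_cases hj : j ∈ s
    · simp [hj]
    · simp [hj, hp j hj]

theorem le_krullDimOf_of_hyperplane_subset {m : ℕ} {V : Set (ℙ K (Fin (m + 1 + 1) → K))}
    {i : Fin (m + 1 + 1)} (hV : {p : ℙ K (Fin (m + 1 + 1) → K) | p.rep i = 0} ⊆ V) :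
    ((m : ℕ∞) : WithBot ℕ∞) ≤ krullDimOf (projZariskiTopology K (m + 1)) V := by
  let s : Fin (m + 1) → Set (Fin (m + 1 + 1)) := fun l => i.succAbove '' Set.Iic l
  refine le_krullDimOf_of_strictMono
    (L := fun l => {p : ℙ K (Fin (m + 1 + 1) → K) | ∀ j ∉ s l, p.rep j = 0})
    (fun l => isClosed_setOf_rep_eq_zero _)
    (fun l => isIrreducible_setOf_rep_eq_zero (Set.nonempty_Iic.image _))
    (fun l p hp => hV (hp i ?_)) fun l l' hl => ?_
  · rintro ⟨j, -, hj⟩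
    exact Fin.succAbove_ne i j hj
  · refine ⟨fun p hp j hj => hp j fun h => hj (Set.image_mono (Set.Iic_subset_Iic.2 hl.le) h),
      fun h => ?_⟩
    have h1 : (Pi.single (i.succAbove l') 1 : Fin (m + 1 + 1) → K) ≠ 0 := by simp
    have h2 := (mk_single_mem_iff h1).1 (h ((mk_single_mem_iff (s := s l') h1).2 ⟨l', Set.self_mem_Iic, rfl⟩))
    obtain ⟨j, hj, he⟩ := h2
    exact absurd (Fin.succAbove_right_injective he ▸ hj : l' ≤ l) hl.not_ge

end LinearSubspace

section Decomposition

variable {k K σ B : Type*} [Field k] [Field K] [Algebra k K]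

theorem exists_eq_sum_C_mul_map (b : Module.Basis B k K) {g : MvPolynomial σ K} {d : ℕ}
    (hg : g.IsHomogeneous d) : ∃ (s : Finset B) (f : B → MvPolynomial σ k),
      (∀ i, (f i).IsHomogeneous d) ∧ g = ∑ i ∈ s, C (b i) * map (algebraMap k K) (f i) := by
  classical
  refine ⟨g.support.biUnion fun m => (b.repr (coeff m g)).support,
    fun i => ∑ m ∈ g.support, monomial m (b.repr (coeff m g) i),
    fun i => IsHomogeneous.sum _ _ _ fun m hm =>
      isHomogeneous_monomial _ (by rw [← hg (mem_support_iff.1 hm), Finsupp.degree_eq_weight_one]; rfl), ?_⟩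
  ext m
  have hcoeff (i : B) : coeff m (∑ m ∈ g.support, monomial m (b.repr (coeff m g) i)) =
      b.repr (coeff m g) i := by
    simp only [coeff_sum, coeff_monomial, Finset.sum_ite_eq']
    split_ifs with h
    · rfl
    · rw [notMem_support_iff.1 h]; simp
  simp only [coeff_sum, coeff_C_mul, coeff_map, hcoeff]
  nth_rewrite 1 [← b.linearCombination_repr (coeff m g)]
  rw [Finsupp.linearCombination_apply]
  by_cases hm : m ∈ g.support
  · rw [Finsupp.sum_of_support_subset _
      (Finset.subset_biUnion_of_mem (fun m => (b.repr (coeff m g)).support) hm) _ (by simp)]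
    exact Finset.sum_congr rfl fun i _ => by rw [Algebra.smul_def, mul_comm]
  · simp [notMem_support_iff.1 hm]

theorem eval_eq_zero_of_sum_C_mul_map (b : Module.Basis B k K) {s : Finset B}
    {f : B → MvPolynomial σ k} {q : σ → k}
    (h : eval (algebraMap k K ∘ q) (∑ i ∈ s, C (b i) * map (algebraMap k K) (f i)) = 0) :
    ∀ i ∈ s, eval q (f i) = 0 := by
  refine linearIndependent_iff'.1 b.linearIndependent s (fun i => eval q (f i)) ?_
  rw [← h, map_sum]
  refine Finset.sum_congr rfl fun i _ => ?_
  rw [Algebra.smul_def, map_mul, eval_C, eval_map, eval₂_comp, mul_comm]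

theorem eq_zero_of_isHomogeneous_of_eval_cons_eq_zero [Infinite k] {n : ℕ} {t : Fin n → K}
    (ht : ∀ g : MvPolynomial (Fin n) k, eval₂ (algebraMap k K) t g = 0 → g = 0)
    {f : MvPolynomial (Fin (n + 1)) k} {d : ℕ} (hf : f.IsHomogeneous d)
    (h : eval (Fin.cons 1 t : Fin (n + 1) → K) (map (algebraMap k K) f) = 0) : f = 0 := by
  have h1 : aeval (Fin.cons 1 X : Fin (n + 1) → MvPolynomial (Fin n) k) f = 0 := by
    refine ht _ ?_
    rw [← h, eval_map, ← aeval_def, ← aeval_def, ← AlgHom.comp_apply, comp_aeval]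
    congr 2
    ext i
    refine Fin.cases ?_ (fun i => ?_) i <;> simp
  have h2 : X 0 * f = 0 := MvPolynomial.funext fun w => by
    by_cases hw : w 0 = 0
    · simp [hw]
    have hw' : w = w 0 • (Fin.cons 1 fun i : Fin n => w i.succ / w 0 : Fin (n + 1) → k) := by
      ext i
      refine Fin.cases ?_ (fun i => ?_) i
      · simp
      · simp [mul_div_cancel₀ _ hw]
    have h3 : eval (Fin.cons 1 fun i : Fin n => w i.succ / w 0 : Fin (n + 1) → k) f = 0 := by
      rw [← map_zero (eval fun i : Fin n => w i.succ / w 0), ← h1, ← aeval_eq_eval, ← aeval_eq_eval,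
        ← AlgHom.comp_apply, comp_aeval]
      congr 2
      ext i
      refine Fin.cases ?_ (fun i => ?_) i <;> simp
    rw [map_mul, map_zero, hw', eval_smul_of_isHomogeneous hf, h3, mul_zero, mul_zero]
  exact (mul_eq_zero.1 h2).resolve_left (X_ne_zero 0)

end Decomposition

section RationalPoints

variable (k : Type*) {K : Type*} [Field k] [Field K] [Algebra k K] {n : ℕ}

/-- The points of projective space over `K` having homogeneous coordinates in `k`. -/
def rationalPoints (K : Type*) [Field K] [Algebra k K] (n : ℕ) : Set (ℙ K (Fin (n + 1) → K)) :=
  {p | ∃ (c : K) (q : Fin (n + 1) → k), p.rep = c • (algebraMap k K ∘ q)}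

variable {k}

theorem eval_comp_eq_zero {p : ℙ K (Fin (n + 1) → K)} {c : K} {q : Fin (n + 1) → k}
    (hp : p.rep = c • (algebraMap k K ∘ q)) {g : MvPolynomial (Fin (n + 1)) K} {d : ℕ}
    (hg : g.IsHomogeneous d) (h : eval p.rep g = 0) : eval (algebraMap k K ∘ q) g = 0 := by
  have hc : c ≠ 0 := by
    rintro rfl
    exact p.rep_nonzero (by simpa using hp)
  rw [hp, eval_smul_of_isHomogeneous hg] at h
  exact (mul_eq_zero.1 h).resolve_left (pow_ne_zero _ hc)

theorem eval_rep_map_eq_zero {T : Set (ℙ K (Fin (n + 1) → K))} {B : Type*}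
    (b : Module.Basis B k K) (hT : T ⊆ closure (T ∩ rationalPoints k K n)) {s : Finset B}
    {f : B → MvPolynomial (Fin (n + 1)) k} {d : ℕ} (hf : ∀ i, (f i).IsHomogeneous d)
    (h : ∀ p ∈ T, eval p.rep (∑ i ∈ s, C (b i) * map (algebraMap k K) (f i)) = 0)
    {y : ℙ K (Fin (n + 1) → K)} (hy : y ∈ T) :
    ∀ i ∈ s, eval y.rep (map (algebraMap k K) (f i)) = 0 := by
  intro i hi
  refine mem_closure_iff.1 (hT hy) d _ ((hf i).map _) ?_
  rintro p ⟨hpT, c, q, hp⟩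
  have hg : (∑ i ∈ s, C (b i) * map (algebraMap k K) (f i)).IsHomogeneous d :=
    IsHomogeneous.sum _ _ _ fun i _ => ((hf i).map _).C_mul _
  have := eval_eq_zero_of_sum_C_mul_map b (eval_comp_eq_zero hp hg (h p hpT)) i hi
  rw [hp, eval_smul_of_isHomogeneous ((hf i).map _), eval_map, ← eval₂_comp, this, map_zero,
    mul_zero]

theorem subset_closure_inter_rationalPoints [IsAlgClosed k] {S : Set (MvPolynomial (Fin (n + 1)) k)}
    (hS : ∀ f ∈ S, ∃ d, f.IsHomogeneous d) {V : Set (ℙ K (Fin (n + 1) → K))}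
    (hV : V = {p | ∀ f ∈ S, eval p.rep (map (algebraMap k K) f) = 0}) :
    V ⊆ closure (V ∩ rationalPoints k K n) := by
  intro p hp
  refine mem_closure_iff.2 fun d g hg hgV => ?_
  let b := Module.Basis.ofVectorSpace k K
  obtain ⟨s, f, hf, rfl⟩ := exists_eq_sum_C_mul_map b hg
  obtain ⟨j, hj⟩ := Function.ne_iff.1 p.rep_nonzero
  have key : ∀ i ∈ s, eval p.rep (map (algebraMap k K) (f i)) = 0 := by
    intro i hi
    have hmem : X j * f i ∈ (Ideal.span S).radical := by
      rw [← vanishingIdeal_zeroLocus_eq_radical (K := k), mem_vanishingIdeal_iff]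
      intro q hq
      rw [aeval_eq_eval, map_mul]
      by_cases hq0 : q = 0
      · simp [hq0]
      have hq' : algebraMap k K ∘ q ≠ 0 := fun h => hq0 <| by
        ext l
        simpa using congrFun h l
      obtain ⟨c, hc⟩ := Projectivization.exists_smul_eq_mk_rep K _ hq'
      have hmk : Projectivization.mk K _ hq' ∈ V ∩ rationalPoints k K n := by
        refine ⟨?_, c, q, hc.symm⟩
        rw [hV]
        intro F hF
        obtain ⟨e, he⟩ := hS F hF
        have : eval q F = 0 := by
          simpa [aeval_eq_eval] using (mem_zeroLocus_iff.1 hq) F (Ideal.subset_span hF)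
        rw [← hc, Units.smul_def, eval_smul_of_isHomogeneous (he.map _), eval_map, ← eval₂_comp,
          this, map_zero, mul_zero]
      rw [eval_eq_zero_of_sum_C_mul_map b (eval_comp_eq_zero hc.symm hg (hgV _ hmk)) i hi, mul_zero]
    obtain ⟨N, hN⟩ := hmem
    have hle : Ideal.span S ≤ RingHom.ker ((eval p.rep).comp (map (algebraMap k K))) :=
      Ideal.span_le.2 fun F hF => by rw [hV] at hp; exact hp F hF
    have := hle hN
    rw [RingHom.mem_ker, map_pow] at this
    have := eq_zero_of_pow_eq_zero this
    rw [RingHom.comp_apply, map_mul, map_mul, map_X, eval_X] at this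
    exact (mul_eq_zero.1 this).resolve_left hj
  rw [map_sum]
  exact Finset.sum_eq_zero fun i hi => by rw [map_mul, key i hi, mul_zero]

end RationalPoints

section GenericPoint

variable {k K : Type*} [Field k] [Field K] {n : ℕ}

theorem pull_map {σ : Type*} [Fintype σ] (φ : k →+* K) (M : Matrix σ σ k) (f : MvPolynomial σ k) :
    pull (M.map φ) (map φ f) = map φ (pull M f) := by
  induction f using MvPolynomial.induction_on with
  | C c => simp [pull, algebraMap_eq]
  | add p q hp hq => simp [hp, hq]
  | mul_X p i hp =>
    rw [map_mul, map_mul, map_mul, map_mul, hp]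
    simp [pull, Matrix.toMvPolynomial_map]

theorem projMatrix_map {σ : Type*} [Fintype σ] [DecidableEq σ] (φ : k →+* K) (v a : σ → k) :
    (projMatrix v a).map φ = projMatrix (φ ∘ v) (φ ∘ a) := by
  ext i j
  simp [projMatrix, Matrix.vecMulVec_apply, Matrix.one_apply, apply_ite φ]

variable [IsAlgClosed k] [Algebra k K] {t : Fin n → K}
  (ht : ∀ g : MvPolynomial (Fin n) k, eval₂ (algebraMap k K) t g = 0 → g = 0)
include ht

theorem pull_eq_zero_of_eval_eq_zero {T : Set (ℙ K (Fin (n + 1) → K))}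
    (hT : T ⊆ closure (T ∩ rationalPoints k K n)) {y : ℙ K (Fin (n + 1) → K)} (hy : y ∈ T)
    {v a : Fin (n + 1) → k} (hav : a ⬝ᵥ v = 1) {α β : K}
    (hx : (Fin.cons 1 t : Fin (n + 1) → K) = α • (algebraMap k K ∘ v) + β • y.rep)
    {g : MvPolynomial (Fin (n + 1)) K} {d : ℕ} (hg : g.IsHomogeneous d)
    (h : ∀ p ∈ T, eval p.rep
      (pull (projMatrix (algebraMap k K ∘ v) (algebraMap k K ∘ a)) g) = 0) :
    pull (projMatrix (algebraMap k K ∘ v) (algebraMap k K ∘ a)) g = 0 := by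
  have := IsAlgClosed.instInfinite (K := k)
  obtain ⟨s, f, hf, rfl⟩ := exists_eq_sum_C_mul_map (Module.Basis.ofVectorSpace k K) hg
  rw [← projMatrix_map] at h ⊢
  have hsum : pull ((projMatrix v a).map (algebraMap k K)) (∑ i ∈ s,
      C (Module.Basis.ofVectorSpace k K i) * map (algebraMap k K) (f i)) =
      ∑ i ∈ s, C (Module.Basis.ofVectorSpace k K i) *
        map (algebraMap k K) (pull (projMatrix v a) (f i)) := by
    rw [map_sum]
    refine Finset.sum_congr rfl fun i _ => ?_
    rw [map_mul, pull_map]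
    simp [pull, algebraMap_eq]
  rw [hsum] at h ⊢
  have hf' (i) := isHomogeneous_pull (projMatrix v a) (hf i)
  refine Finset.sum_eq_zero fun i hi => ?_
  rw [eq_zero_of_isHomogeneous_of_eval_cons_eq_zero ht (hf' i), map_zero, mul_zero]
  have hyi := eval_rep_map_eq_zero _ hT hf' h hy i hi
  have hP : ((projMatrix v a).map (algebraMap k K)).mulVec (Fin.cons 1 t : Fin (n + 1) → K) =
      ((projMatrix v a).map (algebraMap k K)).mulVec (β • y.rep) := by
    have hav' : (algebraMap k K ∘ a) ⬝ᵥ (algebraMap k K ∘ v) = 1 := by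
      rw [← map_one (algebraMap k K), ← hav, RingHom.map_dotProduct]
    rw [hx, Matrix.mulVec_add, Matrix.mulVec_smul, projMatrix_map, projMatrix_mulVec_self hav',
      smul_zero, zero_add]
  rw [← pull_map, eval_pull, hP, ← eval_pull, pull_map, eval_smul_of_isHomogeneous ((hf' i).map _),
    hyi, mul_zero]

theorem le_krullDimOf_of_mem_secant [IsAlgClosed K] (hn : n ≠ 0) {T : Set (ℙ K (Fin (n + 1) → K))}
    (hTc : IsClosed T) (hT : T ⊆ closure (T ∩ rationalPoints k K n))
    {p y : ℙ K (Fin (n + 1) → K)} (hp : p ∈ rationalPoints k K n) (hpT : p ∉ T) (hy : y ∈ T)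
    {α β : K} (hx : (Fin.cons 1 t : Fin (n + 1) → K) = α • p.rep + β • y.rep) :
    (((n - 1 : ℕ) : ℕ∞) : WithBot ℕ∞) ≤ krullDimOf (projZariskiTopology K n) T := by
  have := IsAlgClosed.instInfinite (K := K)
  obtain ⟨c, q, hpq⟩ := hp
  have hq : q ≠ 0 := by
    rintro rfl
    refine p.rep_nonzero (hpq.trans ?_)
    ext
    simp
  obtain ⟨i, hi⟩ := Function.ne_iff.1 hq
  set v : Fin (n + 1) → k := (q i)⁻¹ • q with hv
  set a : Fin (n + 1) → k := Pi.single i 1 with ha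
  have hav : a ⬝ᵥ v = 1 := by simpa [ha, hv] using inv_mul_cancel₀ hi
  have hpv : p.rep = (c * algebraMap k K (q i)) • (algebraMap k K ∘ v) := by
    rw [hpq]
    ext j
    have : algebraMap k K (q i) ≠ 0 := by simpa using hi
    simp [hv]
    field_simp
  have hav' : (algebraMap k K ∘ a) ⬝ᵥ (algebraMap k K ∘ v) = 1 := by
    rw [← map_one (algebraMap k K), ← hav, RingHom.map_dotProduct]
  obtain ⟨π, hπ⟩ := exists_isProjection hav'
  have hcenter : hπ.center = p := by
    rw [IsProjection.center, ← p.mk_rep, eq_comm, Projectivization.mk_eq_mk_iff']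
    exact ⟨_, hpv.symm⟩
  have hcT : hπ.center ∉ T := hcenter ▸ hpT
  rw [← hπ.krullDimOf_image hTc hcT]
  obtain ⟨m, rfl⟩ := Nat.exists_eq_succ_of_ne_zero hn
  refine le_krullDimOf_of_hyperplane_subset (i := i) fun z hz => ?_
  rw [← (hπ.isClosed_image hTc hcT).closure_eq, mem_closure_iff]
  intro d g hg hgT
  have h0 := pull_eq_zero_of_eval_eq_zero ht hT hy hav (α := α * (c * algebraMap k K (q i)))
    (β := β) (by rw [hx, hpv, smul_smul]) hg fun y' hy' =>
      (hπ.eval_apply_eq_zero_iff (fun h => hcT (h ▸ hy')) hg).1 (hgT _ ⟨y', hy', rfl⟩)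
  have hz' : (projMatrix (algebraMap k K ∘ v) (algebraMap k K ∘ a)).mulVec z.rep = z.rep := by
    have : algebraMap k K ∘ a = Pi.single i 1 := by
      ext j
      simp [ha, Pi.single_apply, apply_ite (algebraMap k K)]
    rw [projMatrix_mulVec, this, single_dotProduct, show z.rep i = 0 from hz]
    simp
  rw [← hz', ← eval_pull, h0, map_zero]

end GenericPoint

section IrreducibleComponents

variable {X Y : Type*} [t : TopologicalSpace X] [u : TopologicalSpace Y] [NoetherianSpace X]
  {V : Set X} {f : X → Y}

theorem exists_mem_irredComps_subset_image (hV : IsClosed V)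
    (hf : ∀ Z ⊆ V, IsClosed Z → IsClosed (f '' Z)) {W : Set Y} (hW : IsIrreducible W)
    (hWV : W ⊆ f '' V) : ∃ T ∈ irredComps t V, W ⊆ f '' T := by
  obtain ⟨F, hF, hFc, hFi, rfl⟩ := NoetherianSpace.exists_finite_set_isClosed_irreducible hV
  have hsub : ∀ Z ∈ F, Z ⊆ ⋃₀ F := fun Z hZ => Set.subset_sUnion_of_mem hZ
  have hfin : ((f '' ·) '' F).Finite := hF.image _
  obtain ⟨_, hz, hWZ⟩ := isIrreducible_iff_sUnion_isClosed.1 hW hfin.toFinset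
    (by simpa using fun Z hZ => hf Z (hsub Z hZ) (hFc Z hZ))
    (by rw [Set.image_sUnion] at hWV; simpa using hWV)
  obtain ⟨Z, hZ, rfl⟩ := hfin.mem_toFinset.1 hz
  obtain ⟨T, hZT, hT⟩ := hF.exists_le_maximal hZ
  refine ⟨T, ⟨⟨hsub T hT.1, hFc T hT.1, hFi T hT.1⟩, ?_⟩, hWZ.trans (Set.image_mono hZT)⟩
  rintro T' ⟨hT'V, -, hT'i⟩ hTT'
  obtain ⟨Z', hZ', hT'Z'⟩ := isIrreducible_iff_sUnion_isClosed.1 hT'i hF.toFinset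
    (by simpa using hFc) (by simpa using hT'V)
  exact hT'Z'.trans (hT.2 (hF.mem_toFinset.1 hZ') (hTT'.trans hT'Z'))

variable (hV : IsClosed V) (hc : ContinuousOn f V)
  (hf : ∀ Z ⊆ V, IsClosed Z → IsClosed (f '' Z))
  (hinj : ∀ T₁ ∈ irredComps t V, ∀ T₂ ∈ irredComps t V, f '' T₁ ⊆ f '' T₂ → T₁ = T₂)
include hV hc hf hinj

theorem irredComps_image : irredComps u (f '' V) = (f '' ·) '' irredComps t V := by
  ext W
  constructor
  · rintro ⟨⟨hWV, hWc, hWi⟩, hmax⟩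
    obtain ⟨T, hT, hWT⟩ := exists_mem_irredComps_subset_image hV hf hWi hWV
    obtain ⟨hTV, hTc, hTi⟩ := hT.1
    exact ⟨T, hT, (hmax ⟨Set.image_mono hTV, hf T hTV hTc, hTi.image f (hc.mono hTV)⟩
      hWT).antisymm hWT⟩
  · rintro ⟨T, hT, rfl⟩
    obtain ⟨hTV, hTc, hTi⟩ := hT.1
    refine ⟨⟨Set.image_mono hTV, hf T hTV hTc, hTi.image f (hc.mono hTV)⟩, ?_⟩
    rintro W ⟨hWV, -, hWi⟩ hTW
    obtain ⟨T', hT', hWT'⟩ := exists_mem_irredComps_subset_image hV hf hWi hWV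
    rwa [hinj T hT T' hT' (Set.Subset.trans hTW hWT')]

theorem ncard_irredComps_image : (irredComps u (f '' V)).ncard = (irredComps t V).ncard := by
  rw [irredComps_image hV hc hf hinj]
  exact Set.InjOn.ncard_image fun T₁ h₁ T₂ h₂ h => hinj T₁ h₁ T₂ h₂ h.subset

theorem isIrreducible_image_iff_of_irredComps : IsIrreducible (f '' V) ↔ IsIrreducible V := by
  refine ⟨fun h => ?_, fun h => h.image f hc⟩
  obtain ⟨T, hT, hVT⟩ := exists_mem_irredComps_subset_image hV hf h subset_rfl
  suffices V ⊆ T by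
    rw [this.antisymm hT.1.1]
    exact hT.1.2.2
  intro p hp
  obtain ⟨T', hT', hpT'⟩ := exists_mem_irredComps_subset_image (f := id) hV
    (fun Z _ hZ => by simpa using hZ) (isIrreducible_singleton (x := p)) (by simpa using hp)
  rw [hinj T hT T' hT' ?_]
  · simpa using hpT'
  · rw [hinj T' hT' T hT ((Set.image_mono hT'.1.1).trans hVT)]

end IrreducibleComponents

section Main

variable {k K : Type*} [Field k] [IsAlgClosed k] [Field K] [IsAlgClosed K] [Algebra k K] {n : ℕ}
  {t : Fin n → K} {V : Set (ℙ K (Fin (n + 1) → K))}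

theorem krullDimOf_mono {X : Type*} [t : TopologicalSpace X] {A B : Set X} (h : A ⊆ B) :
    krullDimOf t A ≤ krullDimOf t B :=
  (IsEmbedding.inclusion h).isInducing.topologicalKrullDim_le

theorem mk_cons_notMem
    (ht : ∀ g : MvPolynomial (Fin n) k, eval₂ (algebraMap k K) t g = 0 → g = 0)
    {S : Set (MvPolynomial (Fin (n + 1)) k)} (hS : ∀ f ∈ S, ∃ d, f.IsHomogeneous d)
    (hV : V = {p | ∀ f ∈ S, eval p.rep (map (algebraMap k K) f) = 0}) (hn : n ≠ 0)
    (hdim : krullDimOf (projZariskiTopology K n) V < (((n - 1 : ℕ) : ℕ∞) : WithBot ℕ∞))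
    (hcons : (Fin.cons (1 : K) t : Fin (n + 1) → K) ≠ 0) :
    Projectivization.mk K (Fin.cons (1 : K) t : Fin (n + 1) → K) hcons ∉ V := by
  have := IsAlgClosed.instInfinite (K := k)
  have := IsAlgClosed.instInfinite (K := K)
  intro hx
  refine hdim.not_ge ?_
  obtain ⟨m, rfl⟩ := Nat.exists_eq_succ_of_ne_zero hn
  refine le_krullDimOf_of_hyperplane_subset (i := 0) fun z _ => ?_
  rw [hV] at hx ⊢
  intro f hf
  obtain ⟨d, hd⟩ := hS f hf
  have h := hx f hf
  rw [← mem_lineIdeal_of_isHomogeneous (hd.map _), lineIdeal_rep_mk,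
    mem_lineIdeal_of_isHomogeneous (hd.map _)] at h
  simp [eq_zero_of_isHomogeneous_of_eval_cons_eq_zero ht hd h]

theorem eq_of_image_subset_image
    (ht : ∀ g : MvPolynomial (Fin n) k, eval₂ (algebraMap k K) t g = 0 → g = 0)
    (hV : V ⊆ closure (V ∩ rationalPoints k K n)) (hVc : IsClosed V) (hn : n ≠ 0)
    (hdim : krullDimOf (projZariskiTopology K n) V < (((n - 1 : ℕ) : ℕ∞) : WithBot ℕ∞))
    {c : K} {a : Fin (n + 1) → K} {π : ℙ K (Fin (n + 1) → K) → ℙ K (Fin (n + 1) → K)}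
    (hπ : IsProjection (c • (Fin.cons 1 t : Fin (n + 1) → K)) a π) (hxV : hπ.center ∉ V)
    {T₁ T₂ : Set (ℙ K (Fin (n + 1) → K))} (h₁ : T₁ ∈ irredComps (projZariskiTopology K n) V)
    (h₂ : T₂ ∈ irredComps (projZariskiTopology K n) V) (h : π '' T₁ ⊆ π '' T₂) : T₁ = T₂ := by
  by_contra hne
  have hd₁ := subset_closure_inter_of_mem_irredComps hVc hV h₁
  have hd₂ := subset_closure_inter_of_mem_irredComps hVc hV h₂
  have hsub : ¬ T₁ ⊆ T₂ := fun hs => hne (hs.antisymm (h₁.2 h₂.1 hs))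
  obtain ⟨p, ⟨hp₁, hpk⟩, hp₂⟩ := Set.not_subset.1 fun hs =>
    hsub (hd₁.trans (closure_minimal hs h₂.1.2.1))
  obtain ⟨y, hy, hyp⟩ := h ⟨p, hp₁, rfl⟩
  obtain ⟨hp0, hp⟩ := hπ.apply_eq p fun h => hxV ((congrArg (· ∈ V) h).mp (h₁.1.1 hp₁))
  obtain ⟨hy0, hy'⟩ := hπ.apply_eq y fun h => hxV ((congrArg (· ∈ V) h).mp (h₂.1.1 hy))
  rw [hp, hy', Projectivization.mk_eq_mk_iff'] at hyp
  obtain ⟨b, hb⟩ := hyp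
  rw [projMatrix_mulVec, projMatrix_mulVec] at hb
  set e : K := a ⬝ᵥ y.rep - b * (a ⬝ᵥ p.rep) with he
  have hxy : (e * c) • (Fin.cons 1 t : Fin (n + 1) → K) = y.rep - b • p.rep := by
    rw [mul_smul, he, sub_smul, mul_smul, ← sub_eq_zero]
    rw [← sub_eq_zero, smul_sub] at hb
    rw [← hb]
    abel
  have hec : e * c ≠ 0 := by
    intro h0
    rw [h0, zero_smul, eq_comm, sub_eq_zero] at hxy
    refine hp₂ ?_
    have : y = p := by
      rw [← y.mk_rep, ← p.mk_rep, Projectivization.mk_eq_mk_iff']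
      exact ⟨b, hxy.symm⟩
    exact this ▸ hy
  refine hdim.not_ge ((le_krullDimOf_of_mem_secant ht hn h₂.1.2.1 hd₂ hpk hp₂ hy
    (α := -((e * c)⁻¹ * b)) (β := (e * c)⁻¹) ?_).trans (krullDimOf_mono h₂.1.1))
  rw [← inv_smul_smul₀ hec (Fin.cons 1 t : Fin (n + 1) → K), hxy, smul_sub, smul_smul, neg_smul]
  abel

end Main

end GenericProjection

open GenericProjection

/-- Projection from a generic point (Lemma A.1 of the appendix): let `k ⊆ K` be
algebraically closed fields, `n ≥ 2`, and `V ⊆ ℙ^n(K)` a Zariski closed set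
defined by homogeneous polynomials with coefficients in `k`, of Krull dimension
strictly less than `n - 1`.  Let `t₁, …, tₙ ∈ K` be algebraically independent
over `k`, `x = [1 : t₁ : ⋯ : tₙ]`, let `H` be the zero set of a nonzero linear
form with `x ∉ H`, and let `π` be the projection from `x` to `H` (sending
`y ≠ x` to the unique point of `H` on the line through `x` and `y`).  Then
`x ∉ V`, `π(V)` is Zariski closed and contained in `H`, `π(V)` has the same
Krull dimension as `V`, and `π(V)` has the same number of irreducible
components as `V`; in particular `π(V)` is irreducible iff `V` is. -/
theorem projection_from_generic_point
    {k K : Type*} [Field k] [IsAlgClosed k] [Field K] [IsAlgClosed K]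
    (ι : k →+* K) (n : ℕ) (hn : 2 ≤ n)
    (S : Set (MvPolynomial (Fin (n + 1)) k))
    (hShom : ∀ f ∈ S, ∃ d, MvPolynomial.IsHomogeneous f d)
    (V : Set (Projectivization K (Fin (n + 1) → K)))
    (hV : V = {p | ∀ f ∈ S,
      MvPolynomial.eval p.rep (MvPolynomial.map ι f) = 0})
    (hdim : krullDimOf (projZariskiTopology K n) V < (((n - 1 : ℕ) : ℕ∞) : WithBot ℕ∞))
    (t : Fin n → K)
    (ht : ∀ g : MvPolynomial (Fin n) k, MvPolynomial.eval₂ ι t g = 0 → g = 0)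
    (x : Projectivization K (Fin (n + 1) → K))
    (hcons : (Fin.cons (1 : K) t : Fin (n + 1) → K) ≠ 0)
    (hx : x = Projectivization.mk K (Fin.cons (1 : K) t : Fin (n + 1) → K) hcons)
    (ℓ : (Fin (n + 1) → K) →ₗ[K] K) (hℓ : ℓ ≠ 0)
    (H : Set (Projectivization K (Fin (n + 1) → K)))
    (hH : H = {p | ℓ p.rep = 0})
    (hxH : x ∉ H)
    (π : Projectivization K (Fin (n + 1) → K) →
      Projectivization K (Fin (n + 1) → K))
    (hπ : ∀ y, y ≠ x → π y ∈ H ∧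
      ∃ (a b : K) (hab : a • x.rep + b • y.rep ≠ 0),
        Projectivization.mk K (a • x.rep + b • y.rep) hab = π y) :
    x ∉ V ∧
      (@IsClosed _ (projZariskiTopology K n) (π '' V) ∧ π '' V ⊆ H) ∧
      krullDimOf (projZariskiTopology K n) (π '' V) =
        krullDimOf (projZariskiTopology K n) V ∧
      (irredComps (projZariskiTopology K n) (π '' V)).ncard =
        (irredComps (projZariskiTopology K n) V).ncard ∧
      (@IsIrreducible _ (projZariskiTopology K n) (π '' V) ↔
        @IsIrreducible _ (projZariskiTopology K n) V) := by
  have hn0 : n ≠ 0 := by lia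
  let _ := ι.toAlgebra
  let _ := projZariskiTopology K n
  have ht' : ∀ g : MvPolynomial (Fin n) k, MvPolynomial.eval₂ (algebraMap k K) t g = 0 → g = 0 := ht
  have hxV : x ∉ V := hx ▸ mk_cons_notMem ht' hShom hV hn0 hdim hcons
  have hVc : IsClosed V := by
    rw [hV]
    simp only [Set.ofPred_forall]
    refine isClosed_iInter fun f => isClosed_iInter fun hf => ?_
    obtain ⟨d, hd⟩ := hShom f hf
    exact isClosed_setOf_eval_eq_zero (hd.map ι)
  have hVd := subset_closure_inter_rationalPoints (K := K) hShom hV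
  have hℓx : ℓ x.rep ≠ 0 := fun h => hxH (by rw [hH]; exact h)
  obtain ⟨c₀, hc₀⟩ := Projectivization.exists_smul_eq_mk_rep K _ hcons
  rw [← hx] at hc₀
  set c : K := (ℓ x.rep)⁻¹ * c₀ with hc
  have hcx : c • (Fin.cons 1 t : Fin (n + 1) → K) = (ℓ x.rep)⁻¹ • x.rep := by
    rw [hc, mul_smul, ← hc₀]; rfl
  have hc0 : c • (Fin.cons 1 t : Fin (n + 1) → K) ≠ 0 := by
    rw [hcx]
    exact smul_ne_zero (inv_ne_zero hℓx) x.rep_nonzero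
  have hcmk : Projectivization.mk K _ hc0 = x := by
    rw [← x.mk_rep, Projectivization.mk_eq_mk_iff']
    exact ⟨_, hcx.symm⟩
  obtain ⟨a, ha⟩ : ∃ a : Fin (n + 1) → K, ∀ w, ℓ w = a ⬝ᵥ w :=
    ⟨fun j => ℓ (Pi.single j 1), fun w => by
      conv_lhs => rw [LinearMap.pi_apply_eq_sum_univ ℓ w]
      refine Finset.sum_congr rfl fun i _ => ?_
      rw [smul_eq_mul, mul_comm]
      congr 2
      ext j
      simp [Pi.single_apply, eq_comm]⟩
  have hac : a ⬝ᵥ c • (Fin.cons 1 t : Fin (n + 1) → K) = 1 := by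
    rw [← ha, hcx, map_smul, smul_eq_mul, inv_mul_cancel₀ hℓx]
  have hpr : IsProjection (c • (Fin.cons 1 t : Fin (n + 1) → K)) a π := by
    refine ⟨hc0, hac, fun y hy => ?_⟩
    have hne := projMatrix_mulVec_rep_ne_zero (a := a) hc0 hy
    obtain ⟨hyH, α, β, hab, he⟩ := hπ y (hcmk ▸ hy)
    refine ⟨hne, ?_⟩
    rw [hH, ← he] at hyH
    obtain ⟨e, hmk⟩ := Projectivization.exists_smul_eq_mk_rep K _ hab
    have hℓ0 : α * ℓ x.rep + β * ℓ y.rep = 0 := by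
      have := hyH
      rw [Set.mem_ofPred_eq, ← hmk, Units.smul_def, map_smul, smul_eq_mul, map_add, map_smul,
        map_smul] at this
      exact (mul_eq_zero.1 this).resolve_left e.ne_zero
    rw [← he, Projectivization.mk_eq_mk_iff']
    refine ⟨β, ?_⟩
    have hα : α = -(β * ℓ y.rep * (ℓ x.rep)⁻¹) := by
      field_simp
      linear_combination hℓ0
    rw [projMatrix_mulVec, hcx, ← ha, hα, smul_sub, smul_smul, smul_smul, neg_smul, mul_assoc]
    abel
  have hcV : hpr.center ∉ V := fun h => hxV ((congrArg (· ∈ V) hcmk).mp h)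
  have hcl : ∀ Z ⊆ V, IsClosed Z → IsClosed (π '' Z) :=
    fun Z hZ hZc => hpr.isClosed_image hZc fun h => hcV (hZ h)
  have hinj : ∀ T₁ ∈ irredComps (projZariskiTopology K n) V,
      ∀ T₂ ∈ irredComps (projZariskiTopology K n) V, π '' T₁ ⊆ π '' T₂ → T₁ = T₂ :=
    fun _ h₁ _ h₂ h => eq_of_image_subset_image ht' hVd hVc hn0 hdim hpr hcV h₁ h₂ h
  have hcont := hpr.continuousOn hcV
  refine ⟨hxV, ⟨hcl V subset_rfl hVc, ?_⟩, hpr.krullDimOf_image hVc hcV,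
    ncard_irredComps_image hVc hcont hcl hinj,
    isIrreducible_image_iff_of_irredComps hVc hcont hcl hinj⟩
  rintro _ ⟨y, hy, rfl⟩
  exact (hπ y fun h => hxV (h ▸ hy)).1
end
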